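/- arXiv:0708.1034 — 2 statements merged into one kernel-verified Lean document; each statement's English description precedes it below -/
import Mathlib

section
/- For every simplified counter machine (S, Γ) with initial configuration (s*, 0, 0) there exist — computably from a code of the SCM — a deterministic multiclass queueing network Q with rational interarrival times, delays and service times (some equal to zero) and buffer capacities equal to 0 or ∞, a nonpreemptive static buffer priority scheduling policy θ, and an initial queue-length vector Q(0), such that the triple (Q, θ, Q(0)) is stable if and only if the SCM started at (s*, 0, 0) is stable. -/
/-- The set of allowed counter increments of a two-counter machine. -/
def CM.Deltas : Set (ℤ × ℤ) := {(-1, 0), (0, -1), (0, 0), (1, 0), (0, 1)}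

/-- One step of a two-counter machine with transition function `Γ`:
a configuration `(s, z₁, z₂)` is updated to `(s', (z₁ + d₁)⁺, (z₂ + d₂)⁺)`
where `(s', (d₁, d₂)) = Γ s 1{z₁ > 0} 1{z₂ > 0}`. -/
def CM.step {S : Type*} (Γ : S → Bool → Bool → S × ℤ × ℤ) (c : S × ℕ × ℕ) : S × ℕ × ℕ :=
  let r := Γ c.1 (decide (0 < c.2.1)) (decide (0 < c.2.2))
  (r.1, ((c.2.1 : ℤ) + r.2.1).toNat, ((c.2.2 : ℤ) + r.2.2).toNat)

/-- The trajectory of the counter machine `Γ` started from configuration `c`. -/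
def CM.traj {S : Type*} (Γ : S → Bool → Bool → S × ℤ × ℤ) (c : S × ℕ × ℕ) (t : ℕ) :
    S × ℕ × ℕ :=
  (CM.step Γ)^[t] c

/-- `Γ` is a valid counter-machine transition function: every increment lies in
`CM.Deltas`, and `Γ` is consistent (it never decrements a counter whose value is zero). -/
def CM.Valid {S : Type*} (Γ : S → Bool → Bool → S × ℤ × ℤ) : Prop :=
  (∀ s b₁ b₂, (Γ s b₁ b₂).2 ∈ CM.Deltas) ∧
  (∀ s b₁ b₂, ((Γ s b₁ b₂).2.1 = -1 → b₁ = true) ∧ ((Γ s b₁ b₂).2.2 = -1 → b₂ = true))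

/-- The machine `Γ` started at configuration `c` is stable: both counter values
are bounded along the trajectory. -/
def CM.Stable {S : Type*} (Γ : S → Bool → Bool → S × ℤ × ℤ) (c : S × ℕ × ℕ) : Prop :=
  ∃ B : ℕ, ∀ t : ℕ, (CM.traj Γ c t).2.1 ≤ B ∧ (CM.traj Γ c t).2.2 ≤ B

/-- `Γ` is a simplified counter machine: the increment applied at each step is a
function of the new state only. -/
def CM.IsSCM {S : Type*} (Γ : S → Bool → Bool → S × ℤ × ℤ) : Prop :=
  ∃ (α : S → Bool → Bool → S) (β : S → ℤ × ℤ),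
    ∀ s b₁ b₂, Γ s b₁ b₂ = (α s b₁ b₂, β (α s b₁ b₂))

/-- The allowed increments, as a type. -/
def CM.Delta : Type := {d : ℤ × ℤ // d ∈ CM.Deltas}

/-- The simplified counter machine associated to a counter machine `Γ`, with state
space `S ⊕ (S × D)`: `Γ' (inl s) b₁ b₂ = (inr (s', Δ), Δ)` where `(s', Δ) = Γ s b₁ b₂`,
and `Γ' (inr (s', Δ)) b₁ b₂ = (inl s', (0, 0))`. -/
def CM.simplify {S : Type*} (Γ : S → Bool → Bool → S × ℤ × ℤ)
    (h : ∀ s b₁ b₂, (Γ s b₁ b₂).2 ∈ CM.Deltas) :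
    (S ⊕ S × CM.Delta) → Bool → Bool → (S ⊕ S × CM.Delta) × ℤ × ℤ
  | Sum.inl s, b₁, b₂ =>
      (Sum.inr ((Γ s b₁ b₂).1, ⟨(Γ s b₁ b₂).2, h s b₁ b₂⟩), (Γ s b₁ b₂).2)
  | Sum.inr p, _, _ => (Sum.inl p.1, (0, 0))

/-- Codes of pairs (two-counter machine with state set `Fin m`, state `s*`). -/
def CMStateCode : Type :=
  Σ m : ℕ, (Fin m → Bool → Bool → Fin m × ℤ × ℤ) × Fin m

instance : Encodable CMStateCode := by unfold CMStateCode; infer_instance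

open scoped Classical

/-- A deterministic multiclass queueing network together with a nonpreemptive static
buffer priority policy: `J` single-server nodes, `N` job classes, `srv i` the server of
class `i`, `cap i` the buffer capacity of class `i` (`none` meaning `∞`), external
class-`i` arrivals exactly at the times `a i * n + b i`, `n = 0, 1, 2, …` (`a i = none`
meaning no external arrivals), deterministic service time `serv i ≥ 0`, routing
`next i` (the unique class `l` with `R i l = 1`, `none` if row `i` of the 0–1
substochastic routing matrix is zero), and priority rank `prio i` of class `i` within
its server (smaller rank = higher priority). -/
structure MQNet where
  J : ℕ
  N : ℕ
  srv : Fin N → Fin J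
  cap : Fin N → Option ℕ
  a : Fin N → Option ℚ
  b : Fin N → ℚ
  serv : Fin N → ℚ
  next : Fin N → Option (Fin N)
  prio : Fin N → ℕ

namespace MQNet

/-- The state of the network: for each class, the number of jobs waiting in its buffer
(not counting a job in service), and for each server, the class of the job currently in
service together with its remaining work (in grid units of `1/q`), if any. -/
def State (J N : ℕ) : Type := (Fin N → ℕ) × (Fin J → Option (Fin N × ℕ))

variable (net : MQNet)

/-- The denominator of an optional rational (`1` for `none`). -/
def oden : Option ℚ → ℕ
  | none => 1
  | some x => x.den

/-- A common denominator `q` for all the (rational) interarrival times, delays and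
service times of the network: every event in the network happens at a time which is an
integer multiple of `1/q`. -/
def q : ℕ := ∏ i : Fin net.N, ((net.b i).den * (net.serv i).den * oden (net.a i))

/-- The service time of class `i`, measured in grid units of `1/q`. -/
def units (i : Fin net.N) : ℕ := (net.serv i * net.q).num.toNat

/-- Attempt to add one job to the buffer of class `l` (either an external arrival or a
job routed to `l` after a service completion elsewhere): if `cap l = ∞` the job is
always accepted; if `cap l` is finite and positive the job is accepted iff the buffer is
not full; if `cap l = 0` the job is accepted iff the server of `l` is idle and can begin
processing it immediately (no class of that server with strictly higher priority has a
waiting job). A rejected job is dropped from the network. -/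
noncomputable def tryAccept (l : Fin net.N) (st : State net.J net.N) :
    State net.J net.N :=
  match net.cap l with
  | none => (Function.update st.1 l (st.1 l + 1), st.2)
  | some 0 =>
      if st.2 (net.srv l) = none ∧
          ∀ k, net.srv k = net.srv l → net.prio k < net.prio l → st.1 k = 0 then
        (Function.update st.1 l (st.1 l + 1), st.2)
      else st
  | some (c + 1) =>
      if st.1 l < c + 1 then (Function.update st.1 l (st.1 l + 1), st.2) else st

/-- Route a job which has just completed service at class `i`: it joins the class
`next i` (if accepted there), and leaves the network if `next i = none`. -/
noncomputable def routeOne (i : Fin net.N) (st : State net.J net.N) :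
    State net.J net.N :=
  match net.next i with
  | none => st
  | some l => net.tryAccept l st

/-- One grid tick of work at server `j`: the remaining work of the job in service (if
any) decreases by one unit; if it reaches zero the job completes service, is routed to
its next class and the server becomes idle. -/
noncomputable def completionStep (st : State net.J net.N) (j : Fin net.J) :
    State net.J net.N :=
  match st.2 j with
  | none => st
  | some (i, r) =>
      if r ≤ 1 then net.routeOne i (st.1, Function.update st.2 j none)
      else (st.1, Function.update st.2 j (some (i, r - 1)))

/-- The service-completion phase of a grid tick. -/
noncomputable def completionPhase (st : State net.J net.N) : State net.J net.N :=
  (List.finRange net.J).foldl net.completionStep st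

/-- Class `i` has an external arrival at grid time `T` (i.e. at real time `T / q`). -/
def hasArrival (i : Fin net.N) (T : ℕ) : Prop :=
  match net.a i with
  | none => False
  | some x => ∃ n : ℕ, (T : ℚ) = (x * n + net.b i) * net.q

/-- The external-arrival phase of grid tick `T`. -/
noncomputable def arrivalPhase (T : ℕ) (st : State net.J net.N) : State net.J net.N :=
  (List.finRange net.N).foldl
    (fun st i => if net.hasArrival i T then net.tryAccept i st else st) st

/-- One instantaneous event: the lowest-indexed idle server having a nonempty buffer
selects, among its nonempty buffers, the job of the class with highest priority; if the
service time of that class is zero the job completes instantly and is routed onward,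
otherwise its (nonpreemptive) service begins. If there is no such server, nothing
happens. -/
noncomputable def micro (st : State net.J net.N) : State net.J net.N :=
  let idle : Finset (Fin net.J) :=
    Finset.univ.filter fun j => st.2 j = none ∧ ∃ i, net.srv i = j ∧ 0 < st.1 i
  if h : idle.Nonempty then
    let j := Classical.choose (Finset.exists_min_image idle (fun j => (j : ℕ)) h)
    let cands : Finset (Fin net.N) :=
      Finset.univ.filter fun i => net.srv i = j ∧ 0 < st.1 i
    if h2 : cands.Nonempty then
      let i := Classical.choose (Finset.exists_min_image cands net.prio h2)
      if net.units i = 0 then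
        net.routeOne i (Function.update st.1 i (st.1 i - 1), st.2)
      else
        (Function.update st.1 i (st.1 i - 1),
          Function.update st.2 j (some (i, net.units i)))
    else st
  else st

/-- An upper bound on the number of instantaneous events that can happen at a single
time instant (each of the finitely many jobs present can visit at most `N` classes,
since the routing is acyclic). -/
def fuel (st : State net.J net.N) : ℕ :=
  ((∑ i, st.1 i) + net.J + net.N + 2) * (net.N + 2)

/-- The instantaneous-cascade phase: instantaneous events are performed until none is
pending (the fuel bound is large enough for the process to reach a fixed point). -/
noncomputable def microPhase (st : State net.J net.N) : State net.J net.N :=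
  net.micro^[net.fuel st] st

/-- One grid tick `T` of the network dynamics: services in progress advance by one unit
of work and completed jobs are routed; then external arrivals due at tick `T` occur;
then idle servers select new jobs (zero-service jobs being processed and routed
instantly). -/
noncomputable def step (T : ℕ) (st : State net.J net.N) : State net.J net.N :=
  net.microPhase (net.arrivalPhase T (net.completionPhase st))

/-- The state of the network at grid time `T`, starting from the initial queue-length
vector `Q0` at time `0`. Since every interarrival time, delay and service time is an
integer multiple of `1/q`, the queue lengths are constant between consecutive grid
times, so this process carries all the information about the queue-length process in
continuous time. -/
noncomputable def stateAt (Q0 : Fin net.N → ℕ) : ℕ → State net.J net.N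
  | 0 => net.step 0 (Q0, fun _ => none)
  | T + 1 => net.step (T + 1) (stateAt Q0 T)

/-- The total number of jobs in the network in state `st` (jobs waiting in buffers plus
jobs in service). -/
def totalQ (st : State net.J net.N) : ℕ :=
  (∑ i, st.1 i) + (Finset.univ.filter fun j => (st.2 j).isSome).card

/-- Well-formedness of the data: positive interarrival times, nonnegative delays and
service times, the priority ranks define a genuine priority order (a permutation) on the
classes of each server, and the 0–1 substochastic routing matrix has spectral radius
`< 1`, i.e. the routing function is acyclic. -/
def WellFormed : Prop :=
  (∀ i x, net.a i = some x → 0 < x) ∧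
  (∀ i, 0 ≤ net.b i) ∧
  (∀ i, 0 ≤ net.serv i) ∧
  (∀ i k, net.srv i = net.srv k → net.prio i = net.prio k → i = k) ∧
  (∃ rank : Fin net.N → ℕ, ∀ i l, net.next i = some l → rank l < rank i)

/-- The triple (network, priority policy, initial queue lengths) is stable: the total
number of jobs in the network remains bounded in time. -/
def Stable (Q0 : Fin net.N → ℕ) : Prop :=
  ∃ M : ℕ, ∀ T : ℕ, net.totalQ (net.stateAt Q0 T) ≤ M

end MQNet

/-- Codes of triples (network, priority policy, initial queue lengths). -/
def MQNetCode : Type :=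
  Σ J : ℕ, Σ N : ℕ,
    (Fin N → Fin J) × (Fin N → Option ℕ) × (Fin N → Option ℚ) × (Fin N → ℚ) ×
      (Fin N → ℚ) × (Fin N → Option (Fin N)) × (Fin N → ℕ) × (Fin N → ℕ)

instance : Encodable MQNetCode := by unfold MQNetCode; infer_instance

/-- The code (natural number) of a triple (network, priority policy, initial queue
lengths), under a fixed effective encoding. -/
noncomputable def MQNet.code (net : MQNet) (Q0 : Fin net.N → ℕ) : ℕ :=
  Encodable.encode
    (⟨net.J, net.N, (net.srv, net.cap, net.a, net.b, net.serv, net.next, net.prio, Q0)⟩ :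
      MQNetCode)

/-- One instantaneous event at the lowest-indexed active server `j`, serving its
highest-priority waiting class `i`. -/
theorem MQNet.micro_eq (net : MQNet) (st : MQNet.State net.J net.N) (j : Fin net.J)
    (i : Fin net.N) (hj : st.2 j = none)
    (hlt : ∀ j' < j, st.2 j' = none → ∀ i', net.srv i' = j' → st.1 i' = 0)
    (hi : net.srv i = j) (hpos : 0 < st.1 i)
    (hmin : ∀ i', net.srv i' = j → 0 < st.1 i' → i' ≠ i → net.prio i < net.prio i') :
    net.micro st =
      if net.units i = 0 then
        net.routeOne i (Function.update st.1 i (st.1 i - 1), st.2)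
      else
        (Function.update st.1 i (st.1 i - 1),
          Function.update st.2 j (some (i, net.units i))) := by
  have hne : (Finset.univ.filter fun j =>
      st.2 j = none ∧ ∃ i, net.srv i = j ∧ 0 < st.1 i).Nonempty :=
    ⟨j, by simpa using ⟨hj, i, hi, hpos⟩⟩
  have hjc : Classical.choose
      (Finset.exists_min_image _ (fun j : Fin net.J => (j : ℕ)) hne) = j := by
    obtain ⟨h1, h2⟩ := Classical.choose_spec
      (Finset.exists_min_image _ (fun j : Fin net.J => (j : ℕ)) hne)
    have h3 := h2 j (by simpa using ⟨hj, i, hi, hpos⟩)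
    generalize Classical.choose
      (Finset.exists_min_image _ (fun j : Fin net.J => (j : ℕ)) hne) = j' at *
    rcases lt_or_eq_of_le h3 with h | h
    · simp only [Finset.mem_filter, Finset.mem_univ, true_and] at h1
      obtain ⟨h4, i', h5, h6⟩ := h1
      exact absurd (hlt j' h h4 i' h5) h6.ne'
    · exact Fin.ext h
  have hne2 : (Finset.univ.filter fun i' => net.srv i' = j ∧ 0 < st.1 i').Nonempty :=
    ⟨i, by simpa using ⟨hi, hpos⟩⟩
  have hic : Classical.choose (Finset.exists_min_image _ net.prio hne2) = i := by
    obtain ⟨h1, h2⟩ := Classical.choose_spec (Finset.exists_min_image _ net.prio hne2)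
    have h3 := h2 i (by simpa using ⟨hi, hpos⟩)
    generalize Classical.choose (Finset.exists_min_image _ net.prio hne2) = i' at *
    by_contra h
    simp only [Finset.mem_filter, Finset.mem_univ, true_and] at h1
    exact absurd h3 (not_le.2 (hmin i' h1.1 h1.2 h))
  subst hjc
  subst hic
  unfold MQNet.micro
  exact (dif_pos hne).trans (dif_pos hne2)

theorem MQNet.micro_eq_self (net : MQNet) (st : MQNet.State net.J net.N)
    (h : ∀ j, st.2 j = none → ∀ i, net.srv i = j → st.1 i = 0) : net.micro st = st := by
  unfold MQNet.micro
  have hne : ¬ (Finset.univ.filter fun j =>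
      st.2 j = none ∧ ∃ i, net.srv i = j ∧ 0 < st.1 i).Nonempty := by
    rintro ⟨j, hj⟩
    simp only [Finset.mem_filter, Finset.mem_univ, true_and] at hj
    obtain ⟨h1, i, h2, h3⟩ := hj
    exact h3.ne' (h j h1 i h2)
  simp only [hne, dif_neg, not_false_eq_true]

/-- `st'` is obtained from `st` by at most `k` instantaneous events. -/
def MQNet.Reaches (net : MQNet) (k : ℕ) (st st' : MQNet.State net.J net.N) : Prop :=
  ∃ n ≤ k, net.micro^[n] st = st'

namespace MQNet.Reaches

variable {net : MQNet} {st st' st'' : MQNet.State net.J net.N} {k l : ℕ}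

theorem refl : net.Reaches 0 st st := ⟨0, le_rfl, rfl⟩

theorem of_micro (h : net.micro st = st') : net.Reaches 1 st st' := ⟨1, le_rfl, h⟩

theorem mono (h : net.Reaches k st st') (hkl : k ≤ l) : net.Reaches l st st' :=
  let ⟨n, hn, e⟩ := h
  ⟨n, hn.trans hkl, e⟩

theorem trans (h : net.Reaches k st st') (h' : net.Reaches l st' st'') :
    net.Reaches (k + l) st st'' := by
  obtain ⟨n, hn, rfl⟩ := h
  obtain ⟨n', hn', rfl⟩ := h'
  exact ⟨n' + n, by omega, Function.iterate_add_apply _ _ _ _⟩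

theorem microPhase_eq (h : net.Reaches 4 st st') (hfix : net.micro st' = st') :
    net.microPhase st = st' := by
  obtain ⟨n, hn, e⟩ := h
  unfold MQNet.microPhase
  have hf : 4 ≤ net.fuel st := by
    unfold MQNet.fuel
    nlinarith [Nat.zero_le (∑ i, st.1 i), Nat.zero_le net.J, Nat.zero_le net.N]
  obtain ⟨d, hd⟩ := Nat.exists_eq_add_of_le' (hn.trans hf)
  rw [hd, Function.iterate_add_apply, e, Function.iterate_fixed hfix]

end MQNet.Reaches

/-- A cyclic program with slots `0, …, P - 1`, one executed at each time unit: slot `x` holds a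
gate (`0` or `1` for a counter to be tested, `2` for none), the duration of its jump and the
counter (`1` or `2`, with `0` for none) to be incremented at the end of the jump. Counters are
tested during the first `H` slots. -/
structure SlotProgram where
  P : ℕ
  H : ℕ
  gate : ℕ → ℕ
  dur : ℕ → ℕ
  add : ℕ → ℕ

namespace SlotProgram

/-- Validity of a slot program: tests occur only strictly within the first `H` slots, and
increments occur only after them. -/
structure Valid (p : SlotProgram) : Prop where
  H_pos : 0 < p.H
  H_lt : p.H < p.P
  gate_le : ∀ x, p.gate x ≤ 2
  gate_range : ∀ x, p.gate x ≠ 2 → 0 < x ∧ x < p.H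
  dur_pos : ∀ x < p.P, 0 < p.dur x
  add_le : ∀ x, p.add x ≤ 2
  add_range : ∀ x < p.P, p.add x ≠ 0 → p.H ≤ x + p.dur x ∧ x + p.dur x < p.P

variable (p : SlotProgram)

/-- Server of each class. Classes `0, 1` are the counters, classes `2, 3` block the servers of
the counters, classes `4 + x` are the probes and classes `4 + P + x` the jumps. -/
def srvN (c : ℕ) : ℕ := if c < 4 then c % 2 else if c < 4 + p.P then p.gate (c - 4) else 2

/-- Delay of the external arrivals of each class. -/
def delayN (c : ℕ) : ℕ := if c < 4 then p.H else c - 4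

/-- Service time of each class. -/
def servN (c : ℕ) : ℕ :=
  if c < 2 then p.H else if c < 4 then p.P - p.H else
    if c < 4 + p.P then 0 else p.dur (c - (4 + p.P))

/-- Routing: `0` when leaving the network, `l + 1` when routed to class `l`. -/
def nextN (c : ℕ) : ℕ :=
  if c < 4 then 0 else if c < 4 + p.P then c + p.P + 1 else p.add (c - (4 + p.P))

/-- Priority rank of each class. -/
def prioN (c : ℕ) : ℕ := if c < 2 then c + 2 else if c < 4 then c - 2 else c

/-- The class with index `k`. -/
def cls (k : ℕ) : Fin (2 * p.P + 4) := Fin.ofNat _ k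

/-- The queueing network running a slot program. -/
abbrev net : MQNet where
  J := 3
  N := 2 * p.P + 4
  srv i := Fin.ofNat 3 (p.srvN i)
  cap i := if (i : ℕ) < 4 then none else some 0
  a i := if (i : ℕ) < 2 then none else if (i : ℕ) < 4 + p.P then some (p.P : ℚ) else none
  b i := (p.delayN i : ℚ)
  serv i := (p.servN i : ℚ)
  next i := if p.nextN i = 0 then none else some (p.cls (p.nextN i - 1))
  prio i := prioN i

variable {p}

theorem val_cls {k : ℕ} (h : k < 2 * p.P + 4) : (p.cls k : ℕ) = k := Nat.mod_eq_of_lt h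

theorem eq_cls_iff {k : ℕ} (h : k < 2 * p.P + 4) (i : Fin (2 * p.P + 4)) :
    i = p.cls k ↔ (i : ℕ) = k := by rw [Fin.ext_iff, val_cls h]

theorem Valid.srvN_le (hp : p.Valid) (c : ℕ) : p.srvN c < 3 := by
  unfold srvN
  have := hp.gate_le (c - 4)
  split_ifs <;> omega

theorem Valid.val_srv (hp : p.Valid) (i : Fin (2 * p.P + 4)) :
    ((p.net.srv i : Fin 3) : ℕ) = p.srvN i := Nat.mod_eq_of_lt (hp.srvN_le i)

theorem prioN_injective : Function.Injective prioN := by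
  intro c d h
  unfold prioN at h
  split_ifs at h <;> omega

theorem q_net : p.net.q = 1 := by
  unfold MQNet.q
  refine Finset.prod_eq_one fun i _ => ?_
  have : MQNet.oden (p.net.a i) = 1 := by
    dsimp only [net]
    split_ifs <;> simp [MQNet.oden]
  rw [this]
  simp

theorem units_net (i : Fin (2 * p.P + 4)) : p.net.units i = p.servN i := by
  unfold MQNet.units
  rw [q_net]
  simp

theorem Valid.wellFormed (hp : p.Valid) : p.net.WellFormed := by
  refine ⟨fun i x h => ?_, fun i => Nat.cast_nonneg _, fun i => Nat.cast_nonneg _,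
    fun i k _ h => Fin.ext (prioN_injective h),
    fun i => if (i : ℕ) < 4 then 0 else if (i : ℕ) < 4 + p.P then 2 else 1, fun i l h => ?_⟩
  · dsimp only [net] at h
    split_ifs at h
    obtain rfl := Option.some.inj h
    exact_mod_cast hp.H_pos.trans hp.H_lt
  · dsimp only [net] at h
    split_ifs at h with h0
    obtain rfl := Option.some.inj h
    have hi := i.2
    have h3 := hp.add_le (i - (4 + p.P))
    have hb : p.nextN i - 1 < 2 * p.P + 4 := by
      unfold nextN
      split_ifs <;> omega
    dsimp only
    rw [val_cls hb]
    unfold nextN at *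
    split_ifs at * <;> omega

/-- Queue lengths during slot `τ`. -/
def buf (τ w₀ w₁ b₀ b₁ e f : ℕ) (i : Fin (2 * p.P + 4)) : ℕ :=
  if (i : ℕ) = 0 then w₀ else if (i : ℕ) = 1 then w₁ else if (i : ℕ) = 2 then b₀ else
    if (i : ℕ) = 3 then b₁ else if (i : ℕ) = 4 + τ then e else
      if (i : ℕ) = 4 + p.P + τ then f else 0

variable {τ w₀ w₁ b₀ b₁ e f : ℕ} {c₀ c₁ c₂ : Option (Fin (2 * p.P + 4) × ℕ)}

theorem update_buf_zero (v : ℕ) : Function.update (buf (p := p) τ w₀ w₁ b₀ b₁ e f) (p.cls 0) v =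
    buf τ v w₁ b₀ b₁ e f := by
  funext i
  simp only [Function.update_apply, eq_cls_iff (show 0 < 2 * p.P + 4 by omega), buf]
  split_ifs <;> rfl

theorem update_buf_one (v : ℕ) : Function.update (buf (p := p) τ w₀ w₁ b₀ b₁ e f) (p.cls 1) v =
    buf τ w₀ v b₀ b₁ e f := by
  funext i
  simp only [Function.update_apply, eq_cls_iff (show 1 < 2 * p.P + 4 by omega), buf]
  split_ifs <;> first | rfl | omega

theorem update_buf_two (v : ℕ) : Function.update (buf (p := p) τ w₀ w₁ b₀ b₁ e f) (p.cls 2) v =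
    buf τ w₀ w₁ v b₁ e f := by
  funext i
  simp only [Function.update_apply, eq_cls_iff (show 2 < 2 * p.P + 4 by omega), buf]
  split_ifs <;> first | rfl | omega

theorem update_buf_three (v : ℕ) :
    Function.update (buf (p := p) τ w₀ w₁ b₀ b₁ e f) (p.cls 3) v = buf τ w₀ w₁ b₀ v e f := by
  funext i
  simp only [Function.update_apply, eq_cls_iff (show 3 < 2 * p.P + 4 by omega), buf]
  split_ifs <;> first | rfl | omega

theorem update_buf_probe (hτ : τ < p.P) (v : ℕ) :
    Function.update (buf (p := p) τ w₀ w₁ b₀ b₁ e f) (p.cls (4 + τ)) v =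
      buf τ w₀ w₁ b₀ b₁ v f := by
  funext i
  simp only [Function.update_apply, eq_cls_iff (show 4 + τ < 2 * p.P + 4 by omega), buf]
  split_ifs <;> first | rfl | omega

theorem update_buf_jump (hτ : τ < p.P) (v : ℕ) :
    Function.update (buf (p := p) τ w₀ w₁ b₀ b₁ e f) (p.cls (4 + p.P + τ)) v =
      buf τ w₀ w₁ b₀ b₁ e v := by
  funext i
  simp only [Function.update_apply, eq_cls_iff (show 4 + p.P + τ < 2 * p.P + 4 by omega), buf]
  split_ifs <;> first | rfl | omega

theorem buf_zero : buf (p := p) τ w₀ w₁ b₀ b₁ e f (p.cls 0) = w₀ := by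
  simp [buf, val_cls (show 0 < 2 * p.P + 4 by omega)]

theorem buf_one : buf (p := p) τ w₀ w₁ b₀ b₁ e f (p.cls 1) = w₁ := by
  simp [buf, val_cls (show 1 < 2 * p.P + 4 by omega)]

theorem buf_two : buf (p := p) τ w₀ w₁ b₀ b₁ e f (p.cls 2) = b₀ := by
  simp [buf, val_cls (show 2 < 2 * p.P + 4 by omega)]

theorem buf_three : buf (p := p) τ w₀ w₁ b₀ b₁ e f (p.cls 3) = b₁ := by
  simp [buf, val_cls (show 3 < 2 * p.P + 4 by omega)]

theorem buf_probe (hτ : τ < p.P) : buf (p := p) τ w₀ w₁ b₀ b₁ e f (p.cls (4 + τ)) = e := by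
  simp only [buf, val_cls (show 4 + τ < 2 * p.P + 4 by omega)]
  split_ifs <;> first | rfl | omega

theorem buf_jump (hτ : τ < p.P) :
    buf (p := p) τ w₀ w₁ b₀ b₁ e f (p.cls (4 + p.P + τ)) = f := by
  simp only [buf, val_cls (show 4 + p.P + τ < 2 * p.P + 4 by omega)]
  split_ifs <;> first | rfl | omega

theorem buf_cases (i : Fin (2 * p.P + 4)) :
    buf τ w₀ w₁ b₀ b₁ e f i = 0 ∨ (i : ℕ) = 0 ∧ buf τ w₀ w₁ b₀ b₁ e f i = w₀ ∨
      (i : ℕ) = 1 ∧ buf τ w₀ w₁ b₀ b₁ e f i = w₁ ∨ (i : ℕ) = 2 ∧ buf τ w₀ w₁ b₀ b₁ e f i = b₀ ∨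
      (i : ℕ) = 3 ∧ buf τ w₀ w₁ b₀ b₁ e f i = b₁ ∨
      (i : ℕ) = 4 + τ ∧ buf τ w₀ w₁ b₀ b₁ e f i = e ∨
      (i : ℕ) = 4 + p.P + τ ∧ buf τ w₀ w₁ b₀ b₁ e f i = f := by
  unfold buf
  split_ifs with h0 h1 h2 h3 h4 h5
  · exact .inr (.inl ⟨h0, rfl⟩)
  · exact .inr (.inr (.inl ⟨h1, rfl⟩))
  · exact .inr (.inr (.inr (.inl ⟨h2, rfl⟩)))
  · exact .inr (.inr (.inr (.inr (.inl ⟨h3, rfl⟩))))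
  · exact .inr (.inr (.inr (.inr (.inr (.inl ⟨h4, rfl⟩)))))
  · exact .inr (.inr (.inr (.inr (.inr (.inr ⟨h5, rfl⟩)))))
  · exact .inl rfl

theorem srvN_zero : p.srvN 0 = 0 := rfl

theorem srvN_one : p.srvN 1 = 1 := rfl

theorem srvN_two : p.srvN 2 = 0 := rfl

theorem srvN_three : p.srvN 3 = 1 := rfl

theorem srvN_probe (hτ : τ < p.P) : p.srvN (4 + τ) = p.gate τ := by simp [srvN, hτ]

theorem srvN_jump : p.srvN (4 + p.P + τ) = 2 := by
  unfold srvN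
  rw [if_neg (by omega), if_neg (by omega)]

theorem prioN_of_le {c : ℕ} (h : 4 ≤ c) : prioN c = c := by
  unfold prioN
  rw [if_neg (by omega), if_neg (by omega)]

/-- The state of the network with queue lengths `buf` and the given services. -/
abbrev mkState (τ w₀ w₁ b₀ b₁ e f : ℕ) (c₀ c₁ c₂ : Option (Fin (2 * p.P + 4) × ℕ)) :
    MQNet.State p.net.J p.net.N :=
  (buf τ w₀ w₁ b₀ b₁ e f, ![c₀, c₁, c₂])

theorem update_server_zero (v : Option (Fin (2 * p.P + 4) × ℕ)) :
    Function.update ![c₀, c₁, c₂] (0 : Fin 3) v = ![v, c₁, c₂] := by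
  funext i; fin_cases i <;> rfl

theorem update_server_one (v : Option (Fin (2 * p.P + 4) × ℕ)) :
    Function.update ![c₀, c₁, c₂] (1 : Fin 3) v = ![c₀, v, c₂] := by
  funext i; fin_cases i <;> rfl

theorem update_server_two (v : Option (Fin (2 * p.P + 4) × ℕ)) :
    Function.update ![c₀, c₁, c₂] (2 : Fin 3) v = ![c₀, c₁, v] := by
  funext i; fin_cases i <;> rfl

theorem Valid.srv_eq_iff (hp : p.Valid) (i : Fin (2 * p.P + 4)) (j : Fin 3) :
    p.net.srv i = j ↔ p.srvN i = j := by
  rw [← hp.val_srv]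
  exact Fin.ext_iff

theorem Valid.micro_eq (hp : p.Valid) (W : Fin (2 * p.P + 4) → ℕ)
    (C : Fin 3 → Option (Fin (2 * p.P + 4) × ℕ)) (j : Fin 3) {k : ℕ} (hk : k < 2 * p.P + 4)
    (hj : C j = none)
    (hlt : ∀ j' < j, C j' = none → ∀ i : Fin (2 * p.P + 4), p.srvN i = j' → W i = 0)
    (hkj : p.srvN k = j) (hpos : 0 < W (p.cls k))
    (hmin : ∀ i : Fin (2 * p.P + 4), p.srvN i = j → 0 < W i → (i : ℕ) ≠ k →
      prioN k < prioN i) :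
    p.net.micro (W, C) =
      if p.servN k = 0 then
        p.net.routeOne (p.cls k) (Function.update W (p.cls k) (W (p.cls k) - 1), C)
      else (Function.update W (p.cls k) (W (p.cls k) - 1),
        Function.update C j (some (p.cls k, p.servN k))) := by
  have hu : p.net.units (p.cls k) = p.servN k := by rw [units_net, val_cls hk]
  rw [← hu]
  refine p.net.micro_eq (W, C) j (p.cls k) hj (fun j' h1 h2 i hi => ?_) ?_ hpos
    fun i hi h1 h2 => ?_
  · exact hlt j' h1 h2 i ((hp.srv_eq_iff _ _).1 hi)
  · exact (hp.srv_eq_iff _ _).2 (by rw [val_cls hk, hkj])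
  · rw [Ne, eq_cls_iff hk] at h2
    have := hmin i ((hp.srv_eq_iff _ _).1 hi) h1 h2
    rwa [← val_cls hk] at this

theorem Valid.micro_start (hp : p.Valid) (W : Fin (2 * p.P + 4) → ℕ)
    (C : Fin 3 → Option (Fin (2 * p.P + 4) × ℕ)) (j : Fin 3) {k : ℕ} (hk : k < 2 * p.P + 4)
    (hs : 0 < p.servN k) (hj : C j = none)
    (hlt : ∀ j' < j, C j' = none → ∀ i : Fin (2 * p.P + 4), p.srvN i = j' → W i = 0)
    (hkj : p.srvN k = j) (hpos : 0 < W (p.cls k))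
    (hmin : ∀ i : Fin (2 * p.P + 4), p.srvN i = j → 0 < W i → (i : ℕ) ≠ k →
      prioN k < prioN i) :
    p.net.micro (W, C) = (Function.update W (p.cls k) (W (p.cls k) - 1),
        Function.update C j (some (p.cls k, p.servN k))) :=
  (hp.micro_eq W C j hk hj hlt hkj hpos hmin).trans (if_neg hs.ne')

theorem Valid.micro_start_blocker_zero (hp : p.Valid) (hb : 0 < b₀) :
    p.net.micro (mkState τ w₀ w₁ b₀ b₁ e f none c₁ c₂) =
      mkState τ w₀ w₁ (b₀ - 1) b₁ e f (some (p.cls 2, p.P - p.H)) c₁ c₂ := by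
  have hP := hp.H_lt
  refine (hp.micro_start _ _ (0 : Fin 3) (k := 2) (by omega) (by simp [servN, hP]) rfl ?_
    (by simp [srvN]) (hb.trans_eq buf_two.symm) ?_).trans ?_
  · exact fun j' hj => absurd hj (Fin.not_lt_zero _)
  · intro i' _ _ hne
    unfold prioN
    split_ifs <;> omega
  · rw [buf_two, update_buf_two, update_server_zero]
    simp [servN]
    rfl

theorem Valid.micro_start_counter_zero (hp : p.Valid) (hw : 0 < w₀) :
    p.net.micro (mkState τ w₀ w₁ 0 b₁ e f none c₁ c₂) =
      mkState τ (w₀ - 1) w₁ 0 b₁ e f (some (p.cls 0, p.H)) c₁ c₂ := by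
  have hP := hp.H_lt
  refine (hp.micro_start _ _ (0 : Fin 3) (k := 0) (by omega) (by simp [servN, hp.H_pos]) rfl ?_
    (by simp [srvN]) (hw.trans_eq buf_zero.symm) ?_).trans ?_
  · exact fun j' hj => absurd hj (Fin.not_lt_zero _)
  · intro i' h1 h2 hne
    have h3 : 3 < (i' : ℕ) := by
      rcases buf_cases i' (w₀ := w₀) (w₁ := w₁) (b₀ := 0) (b₁ := b₁) (e := e) (f := f) (τ := τ)
        with h | h | h | h | h | h | h
      · omega
      · omega
      · rw [h.1, srvN_one] at h1
        exact absurd h1 one_ne_zero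
      · omega
      · rw [h.1, srvN_three] at h1
        exact absurd h1 one_ne_zero
      all_goals omega
    unfold prioN
    split_ifs <;> omega
  · rw [buf_zero, update_buf_zero, update_server_zero]
    simp [servN]
    rfl

/-- No event can occur at the server of a counter. -/
theorem buf_eq_zero (hτ : τ < p.P) {v : ℕ} (hv : v < 2) (hw : v = 0 → w₀ = 0 ∧ b₀ = 0)
    (hb : v = 1 → w₁ = 0 ∧ b₁ = 0) (he : p.gate τ = v → e = 0) {i : Fin (2 * p.P + 4)}
    (hi : p.srvN i = v) :
    buf τ w₀ w₁ b₀ b₁ e f i = 0 := by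
  rcases buf_cases i (w₀ := w₀) (w₁ := w₁) (b₀ := b₀) (b₁ := b₁) (e := e) (f := f) (τ := τ)
    with h | ⟨h, h'⟩ | ⟨h, h'⟩ | ⟨h, h'⟩ | ⟨h, h'⟩ | ⟨h, h'⟩ | ⟨h, h'⟩
  · exact h
  all_goals
    rw [h']
    rw [h] at hi
  · exact (hw hi.symm).1
  · exact (hb hi.symm).1
  · exact (hw hi.symm).2
  · exact (hb hi.symm).2
  · exact he ((srvN_probe hτ).symm.trans hi)
  · rw [srvN_jump] at hi
    omega

theorem Valid.micro_start_blocker_one (hp : p.Valid) (hτ : τ < p.P) (hb : 0 < b₁)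
    (h₀ : c₀ = none → w₀ = 0 ∧ b₀ = 0) (he : p.gate τ = 0 → e = 0) :
    p.net.micro (mkState τ w₀ w₁ b₀ b₁ e f c₀ none c₂) =
      mkState τ w₀ w₁ b₀ (b₁ - 1) e f c₀ (some (p.cls 3, p.P - p.H)) c₂ := by
  have hP := hp.H_lt
  refine (hp.micro_start _ _ (1 : Fin 3) (k := 3) (by omega) (by simp [servN, hP]) rfl ?_
    (by simp [srvN]) (hb.trans_eq buf_three.symm) ?_).trans ?_
  · intro j' hj hc i hi
    obtain rfl : j' = 0 := (Fin.lt_one_iff _).1 hj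
    exact buf_eq_zero hτ (by omega) (fun _ => h₀ hc) (by simp) he hi
  · intro i' h1 h2 hne
    have h3 : (i' : ℕ) ≠ 2 := fun h => by
      rw [h, srvN_two] at h1
      exact zero_ne_one h1
    have h4 : (i' : ℕ) ≠ 0 := fun h => by
      rw [h, srvN_zero] at h1
      exact zero_ne_one h1
    unfold prioN
    split_ifs <;> omega
  · rw [buf_three, update_buf_three, update_server_one]
    simp [servN]
    rfl

theorem Valid.micro_start_counter_one (hp : p.Valid) (hτ : τ < p.P) (hw : 0 < w₁)
    (h₀ : c₀ = none → w₀ = 0 ∧ b₀ = 0) (he : p.gate τ = 0 → e = 0) :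
    p.net.micro (mkState τ w₀ w₁ b₀ 0 e f c₀ none c₂) =
      mkState τ w₀ (w₁ - 1) b₀ 0 e f c₀ (some (p.cls 1, p.H)) c₂ := by
  have hP := hp.H_lt
  refine (hp.micro_start _ _ (1 : Fin 3) (k := 1) (by omega) (by simp [servN, hp.H_pos]) rfl ?_
    (by simp [srvN]) (hw.trans_eq buf_one.symm) ?_).trans ?_
  · intro j' hj hc i hi
    obtain rfl : j' = 0 := (Fin.lt_one_iff _).1 hj
    exact buf_eq_zero hτ (by omega) (fun _ => h₀ hc) (by simp) he hi
  · intro i' h1 h2 hne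
    have h3 : 3 < (i' : ℕ) := by
      rcases buf_cases i' (w₀ := w₀) (w₁ := w₁) (b₀ := b₀) (b₁ := 0) (e := e) (f := f) (τ := τ)
        with h | h | h | h | h | h | h
      · omega
      · rw [h.1, srvN_zero] at h1
        exact absurd h1 zero_ne_one
      · omega
      · rw [h.1, srvN_two] at h1
        exact absurd h1 zero_ne_one
      all_goals omega
    unfold prioN
    split_ifs <;> omega
  · rw [buf_one, update_buf_one, update_server_one]
    simp [servN]
    rfl

theorem tryAccept_net {l : ℕ} (h4 : 4 ≤ l) (hl : l < 2 * p.P + 4) (W : Fin (2 * p.P + 4) → ℕ)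
    (C : Fin 3 → Option (Fin (2 * p.P + 4) × ℕ)) :
    p.net.tryAccept (p.cls l) (W, C) =
      if C (p.net.srv (p.cls l)) = none ∧ ∀ k, p.net.srv k = p.net.srv (p.cls l) →
          p.net.prio k < p.net.prio (p.cls l) → W k = 0 then
        (Function.update W (p.cls l) (W (p.cls l) + 1), C)
      else (W, C) := by
  have hc : p.net.cap (p.cls l) = some 0 := by
    dsimp only [net]
    rw [val_cls hl, if_neg (by omega)]
  unfold MQNet.tryAccept
  rw [hc]
  rfl

theorem Valid.tryAccept_jump (hp : p.Valid) (hτ : τ < p.P) :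
    p.net.tryAccept (p.cls (4 + p.P + τ)) (mkState τ w₀ w₁ b₀ b₁ 0 0 c₀ c₁ c₂) =
      mkState τ w₀ w₁ b₀ b₁ 0 (if c₂ = none then 1 else 0) c₀ c₁ c₂ := by
  have hl : 4 + p.P + τ < 2 * p.P + 4 := by omega
  have hs : p.net.srv (p.cls (4 + p.P + τ)) = (2 : Fin 3) := by
    refine (hp.srv_eq_iff _ _).2 ?_
    rw [val_cls hl]
    simp [srvN]
    omega
  refine (tryAccept_net (by omega) hl _ _).trans ?_
  rw [hs]
  by_cases hc : c₂ = none
  · rw [if_pos, if_pos hc, buf_jump hτ, update_buf_jump hτ]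
    · refine ⟨hc, fun k hk1 _ => ?_⟩
      have hk := (hp.srv_eq_iff _ _).1 hk1
      rcases buf_cases k (w₀ := w₀) (w₁ := w₁) (b₀ := b₀) (b₁ := b₁) (e := 0) (f := 0) (τ := τ)
        with h | ⟨h, h'⟩ | ⟨h, h'⟩ | ⟨h, h'⟩ | ⟨h, h'⟩ | ⟨-, h⟩ | ⟨-, h⟩
      · exact h
      · rw [h, srvN_zero] at hk
        exact absurd hk (by simp)
      · rw [h, srvN_one] at hk
        exact absurd hk (by simp)
      · rw [h, srvN_two] at hk
        exact absurd hk (by simp)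
      · rw [h, srvN_three] at hk
        exact absurd hk (by simp)
      · exact h
      · exact h
  · rw [if_neg (fun h => hc h.1), if_neg hc]

/-- The server tested by the current slot is idle. -/
def IsOpen (p : SlotProgram) (τ : ℕ) (c₀ c₁ c₂ : Option (Fin (2 * p.P + 4) × ℕ)) : Prop :=
  (p.gate τ = 0 → c₀ = none) ∧ (p.gate τ = 1 → c₁ = none) ∧ (p.gate τ = 2 → c₂ = none)

theorem Valid.tryAccept_probe (hp : p.Valid) (hτ : τ < p.P)
    (h₀ : p.gate τ = 0 → c₀ = none → w₀ = 0 ∧ b₀ = 0)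
    (h₁ : p.gate τ = 1 → c₁ = none → w₁ = 0 ∧ b₁ = 0) :
    p.net.tryAccept (p.cls (4 + τ)) (mkState τ w₀ w₁ b₀ b₁ 0 0 c₀ c₁ c₂) =
      mkState τ w₀ w₁ b₀ b₁ (if IsOpen p τ c₀ c₁ c₂ then 1 else 0) 0 c₀ c₁ c₂ := by
  have hl : 4 + τ < 2 * p.P + 4 := by omega
  have hs : p.srvN (4 + τ) = p.gate τ := srvN_probe hτ
  have hs' : (p.net.srv (p.cls (4 + τ)) : Fin 3).val = p.gate τ := by
    rw [hp.val_srv, val_cls hl, hs]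
  have hidle : (![c₀, c₁, c₂] : Fin 3 → _) (p.net.srv (p.cls (4 + τ))) = none ↔
      IsOpen p τ c₀ c₁ c₂ := by
    generalize (p.net.srv (p.cls (4 + τ)) : Fin 3) = j at *
    unfold IsOpen
    rw [← hs']
    fin_cases j <;> simp
  refine (tryAccept_net (by omega) hl _ _).trans ?_
  by_cases hc : IsOpen p τ c₀ c₁ c₂
  · rw [if_pos, if_pos hc, buf_probe hτ, update_buf_probe hτ]
    refine ⟨hidle.2 hc, fun k hk1 _ => ?_⟩
    have hk := (hp.srv_eq_iff _ _).1 hk1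
    rw [hs'] at hk
    have h0 : p.gate τ = 0 → w₀ = 0 ∧ b₀ = 0 := fun h => h₀ h (hc.1 h)
    have h1 : p.gate τ = 1 → w₁ = 0 ∧ b₁ = 0 := fun h => h₁ h (hc.2.1 h)
    rcases buf_cases k (w₀ := w₀) (w₁ := w₁) (b₀ := b₀) (b₁ := b₁) (e := 0) (f := 0) (τ := τ)
        with h | ⟨h, h'⟩ | ⟨h, h'⟩ | ⟨h, h'⟩ | ⟨h, h'⟩ | ⟨-, h⟩ | ⟨-, h⟩
    · exact h
    · rw [h, srvN_zero] at hk
      exact h'.trans (h0 hk.symm).1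
    · rw [h, srvN_one] at hk
      exact h'.trans (h1 hk.symm).1
    · rw [h, srvN_two] at hk
      exact h'.trans (h0 hk.symm).2
    · rw [h, srvN_three] at hk
      exact h'.trans (h1 hk.symm).2
    · exact h
    · exact h
  · rw [if_neg (fun h => hc (hidle.1 h.1)), if_neg hc]

theorem Valid.micro_probe (hp : p.Valid) (hτ : τ < p.P) (h₀ : c₀ = none → w₀ = 0 ∧ b₀ = 0)
    (h₁ : c₁ = none → w₁ = 0 ∧ b₁ = 0) (ho : IsOpen p τ c₀ c₁ c₂) :
    p.net.micro (mkState τ w₀ w₁ b₀ b₁ 1 0 c₀ c₁ c₂) =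
      mkState τ w₀ w₁ b₀ b₁ 0 (if c₂ = none then 1 else 0) c₀ c₁ c₂ := by
  have hl : 4 + τ < 2 * p.P + 4 := by omega
  have hg := hp.gate_le τ
  have hs : p.servN (4 + τ) = 0 := by
    unfold servN
    rw [if_neg (by omega), if_neg (by omega), if_pos (by omega)]
  refine (hp.micro_eq _ _ (Fin.ofNat 3 (p.gate τ)) hl ?_ ?_ ?_ ?_ ?_).trans ?_
  · obtain h | h | h : p.gate τ = 0 ∨ p.gate τ = 1 ∨ p.gate τ = 2 := by omega
    · rw [h]
      exact ho.1 h
    · rw [h]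
      exact ho.2.1 h
    · rw [h]
      exact ho.2.2 h
  · intro j' hj hc i hi
    have hj' : (j' : ℕ) < p.gate τ := by
      rwa [Fin.lt_def, Fin.val_ofNat, Nat.mod_eq_of_lt (by omega)] at hj
    refine buf_eq_zero hτ (v := j') (by omega) (fun h => h₀ ?_) (fun h => h₁ ?_) (fun h => ?_) hi
    · obtain rfl : j' = 0 := Fin.ext h
      exact hc
    · obtain rfl : j' = 1 := Fin.ext h
      exact hc
    · omega
  · rw [Fin.val_ofNat, Nat.mod_eq_of_lt (by omega)]
    simp [srvN, hτ]
  · rw [buf_probe hτ]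
    exact one_pos
  · intro i' h1 h2 hne
    rw [Fin.val_ofNat, Nat.mod_eq_of_lt (by omega)] at h1
    have h0 : p.gate τ = 0 → w₀ = 0 ∧ b₀ = 0 := fun h => h₀ (ho.1 h)
    have h1' : p.gate τ = 1 → w₁ = 0 ∧ b₁ = 0 := fun h => h₁ (ho.2.1 h)
    have h3 : 4 + τ < (i' : ℕ) := by
      rcases buf_cases i' (w₀ := w₀) (w₁ := w₁) (b₀ := b₀) (b₁ := b₁) (e := 1) (f := 0) (τ := τ)
        with h | ⟨h, h'⟩ | ⟨h, h'⟩ | ⟨h, h'⟩ | ⟨h, h'⟩ | ⟨h, -⟩ | ⟨-, h⟩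
      · omega
      · rw [h, srvN_zero] at h1
        have := h0 h1.symm
        omega
      · rw [h, srvN_one] at h1
        have := h1' h1.symm
        omega
      · rw [h, srvN_two] at h1
        have := h0 h1.symm
        omega
      · rw [h, srvN_three] at h1
        have := h1' h1.symm
        omega
      all_goals omega
    rw [prioN_of_le (by omega), prioN_of_le (by omega)]
    exact h3
  · have hn : p.net.next (p.cls (4 + τ)) = some (p.cls (4 + p.P + τ)) := by
      dsimp only [net]
      rw [val_cls hl]
      have : p.nextN (4 + τ) = 4 + p.P + τ + 1 := by
        simp [nextN, hτ]
        omega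
      rw [this, if_neg (by omega)]
      rfl
    refine (if_pos hs).trans ?_
    rw [buf_probe hτ, update_buf_probe hτ]
    unfold MQNet.routeOne
    rw [hn]
    exact hp.tryAccept_jump hτ

theorem Valid.micro_jump (hp : p.Valid) (hτ : τ < p.P) (h₀ : c₀ = none → w₀ = 0 ∧ b₀ = 0)
    (h₁ : c₁ = none → w₁ = 0 ∧ b₁ = 0) :
    p.net.micro (mkState τ w₀ w₁ b₀ b₁ 0 1 c₀ c₁ none) =
      mkState τ w₀ w₁ b₀ b₁ 0 0 c₀ c₁ (some (p.cls (4 + p.P + τ), p.dur τ)) := by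
  have hl : 4 + p.P + τ < 2 * p.P + 4 := by omega
  have hs : p.servN (4 + p.P + τ) = p.dur τ := by
    unfold servN
    rw [if_neg (by omega), if_neg (by omega), if_neg (by omega)]
    congr 1
    omega
  refine (hp.micro_start _ _ (2 : Fin 3) hl ?_ rfl ?_ ?_ ?_ ?_).trans ?_
  · rw [hs]
    exact hp.dur_pos τ hτ
  · intro j' hj hc i hi
    have hj' : (j' : ℕ) < 2 := hj
    refine buf_eq_zero hτ (v := j') (by omega) (fun h => h₀ ?_) (fun h => h₁ ?_) (fun h => rfl) hi
    · obtain rfl : j' = 0 := Fin.ext h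
      exact hc
    · obtain rfl : j' = 1 := Fin.ext h
      exact hc
  · unfold srvN
    rw [if_neg (by omega), if_neg (by omega)]
    rfl
  · rw [buf_jump hτ]
    exact one_pos
  · intro i' h1 h2 hne
    rcases buf_cases i' (w₀ := w₀) (w₁ := w₁) (b₀ := b₀) (b₁ := b₁) (e := 0) (f := 1) (τ := τ)
      with h | ⟨h, h'⟩ | ⟨h, h'⟩ | ⟨h, h'⟩ | ⟨h, h'⟩ | ⟨-, h⟩ | ⟨h, -⟩
    · omega
    · rw [h, srvN_zero] at h1
      exact absurd h1 (by simp)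
    · rw [h, srvN_one] at h1
      exact absurd h1 (by simp)
    · rw [h, srvN_two] at h1
      exact absurd h1 (by simp)
    · rw [h, srvN_three] at h1
      exact absurd h1 (by simp)
    all_goals omega
  · rw [buf_jump hτ, update_buf_jump hτ, update_server_two, hs]

theorem Valid.micro_idle (hp : p.Valid) (hτ : τ < p.P) (h₀ : c₀ = none → w₀ = 0 ∧ b₀ = 0)
    (h₁ : c₁ = none → w₁ = 0 ∧ b₁ = 0) :
    p.net.micro (mkState τ w₀ w₁ b₀ b₁ 0 0 c₀ c₁ c₂) =
      mkState τ w₀ w₁ b₀ b₁ 0 0 c₀ c₁ c₂ := by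
  refine p.net.micro_eq_self _ fun j hc i hi => ?_
  replace hi := (hp.srv_eq_iff _ _).1 hi
  by_cases hj : (j : ℕ) = 2
  · change buf _ _ _ _ _ _ _ _ = 0
    rw [hj] at hi
    rcases buf_cases i (w₀ := w₀) (w₁ := w₁) (b₀ := b₀) (b₁ := b₁) (e := 0) (f := 0) (τ := τ)
      with h | ⟨h, h'⟩ | ⟨h, h'⟩ | ⟨h, h'⟩ | ⟨h, h'⟩ | ⟨-, h⟩ | ⟨-, h⟩
    · exact h
    · rw [h, srvN_zero] at hi
      exact absurd hi (by simp)
    · rw [h, srvN_one] at hi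
      exact absurd hi (by simp)
    · rw [h, srvN_two] at hi
      exact absurd hi (by simp)
    · rw [h, srvN_three] at hi
      exact absurd hi (by simp)
    · exact h
    · exact h
  · have h3 : (j : ℕ) < 3 := j.2
    refine buf_eq_zero hτ (v := j) (by omega) (fun h => h₀ ?_) (fun h => h₁ ?_) (fun h => rfl) hi
    · obtain rfl : j = (0 : Fin 3) := Fin.ext h
      exact hc
    · obtain rfl : j = (1 : Fin 3) := Fin.ext h
      exact hc

/-- The service started by an accepted probe. -/
noncomputable def jumpService (p : SlotProgram) (τ : ℕ)
    (c₀ c₁ c₂ : Option (Fin (2 * p.P + 4) × ℕ)) : Option (Fin (2 * p.P + 4) × ℕ) :=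
  if IsOpen p τ c₀ c₁ c₂ ∧ c₂ = none then some (p.cls (4 + p.P + τ), p.dur τ) else c₂

theorem Valid.reaches_jump (hp : p.Valid) (hτ : τ < p.P) (h₀ : c₀ = none → w₀ = 0 ∧ b₀ = 0)
    (h₁ : c₁ = none → w₁ = 0 ∧ b₁ = 0) {e : ℕ} (he : e = if IsOpen p τ c₀ c₁ c₂ then 1 else 0) :
    p.net.Reaches 2 (mkState τ w₀ w₁ b₀ b₁ e 0 c₀ c₁ c₂)
      (mkState τ w₀ w₁ b₀ b₁ 0 0 c₀ c₁ (jumpService p τ c₀ c₁ c₂)) := by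
  subst he
  unfold jumpService
  by_cases ho : IsOpen p τ c₀ c₁ c₂
  · have h := MQNet.Reaches.of_micro (hp.micro_probe hτ h₀ h₁ ho)
    rw [if_pos ho]
    refine h.trans (l := 1) ?_
    by_cases hc : c₂ = none
    · rw [if_pos hc, if_pos ⟨ho, hc⟩, hc]
      exact MQNet.Reaches.of_micro (hp.micro_jump hτ h₀ h₁)
    · rw [if_neg hc, if_neg fun h => hc h.2]
      exact MQNet.Reaches.refl.mono (by omega)
  · rw [if_neg ho, if_neg fun h => ho h.1]
    exact MQNet.Reaches.refl.mono (by omega)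

theorem Valid.reaches_counters (hp : p.Valid) (hτ : τ < p.P) (hg : p.gate τ = 2) :
    p.net.Reaches 2 (mkState τ w₀ w₁ 0 0 e f none none c₂)
      (mkState τ (w₀ - 1) (w₁ - 1) 0 0 e f (if 0 < w₀ then some (p.cls 0, p.H) else none)
        (if 0 < w₁ then some (p.cls 1, p.H) else none) c₂) := by
  have hg' : p.gate τ = 0 → e = 0 := fun h => by omega
  have h1 : p.net.Reaches 1 (mkState τ w₀ w₁ 0 0 e f none none c₂)
      (mkState τ (w₀ - 1) w₁ 0 0 e f (if 0 < w₀ then some (p.cls 0, p.H) else none)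
        none c₂) := by
    by_cases h : 0 < w₀
    · rw [if_pos h]
      exact .of_micro (hp.micro_start_counter_zero h)
    · obtain rfl : w₀ = 0 := by omega
      exact MQNet.Reaches.refl.mono zero_le_one
  refine h1.trans (l := 1) ?_
  by_cases h : 0 < w₁
  · rw [if_pos h]
    refine .of_micro (hp.micro_start_counter_one hτ h (fun h0 => ⟨?_, rfl⟩) hg')
    by_contra h2
    rw [if_pos (by omega)] at h0
    exact absurd h0 (by simp)
  · obtain rfl : w₁ = 0 := by omega
    exact MQNet.Reaches.refl.mono zero_le_one

theorem Valid.reaches_blockers (hp : p.Valid) (hτ : τ < p.P) (hg : p.gate τ = 2) :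
    p.net.Reaches 2 (mkState τ w₀ w₁ 1 1 e f none none c₂)
      (mkState τ w₀ w₁ 0 0 e f (some (p.cls 2, p.P - p.H)) (some (p.cls 3, p.P - p.H)) c₂) :=
  (MQNet.Reaches.of_micro (hp.micro_start_blocker_zero one_pos)).trans (l := 1)
    (.of_micro (hp.micro_start_blocker_one hτ one_pos (fun h => absurd h (by simp))
      fun h => by omega))

theorem Valid.delayN_lt (hp : p.Valid) {c : ℕ} (hc : c < 4 + p.P) : p.delayN c < p.P := by
  have := hp.H_lt
  unfold delayN
  split_ifs <;> omega

theorem Valid.hasArrival_iff (hp : p.Valid) (i : Fin (2 * p.P + 4)) (T : ℕ) :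
    p.net.hasArrival i T ↔ 2 ≤ (i : ℕ) ∧ (i : ℕ) < 4 + p.P ∧ T % p.P = p.delayN i := by
  unfold MQNet.hasArrival
  rw [q_net]
  dsimp only [net]
  split_ifs with h1 h2
  · exact iff_of_false id fun h => by omega
  · have hd := hp.delayN_lt h2
    simp only [Nat.cast_one, mul_one]
    refine ⟨fun ⟨n, hn⟩ => ⟨by omega, h2, ?_⟩, fun ⟨_, _, h⟩ => ⟨T / p.P, ?_⟩⟩
    · have : T = p.P * n + p.delayN i := by exact_mod_cast hn
      rw [this, Nat.mul_add_mod, Nat.mod_eq_of_lt hd]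
    · rw [← h]
      exact_mod_cast (Nat.div_add_mod T p.P).symm
  · exact iff_of_false id fun h => by omega

theorem eq_filter_finRange {n : ℕ} {q : Fin n → Bool} {l : List (Fin n)}
    (hl : l.Pairwise (· < ·)) (h : ∀ i, i ∈ l ↔ q i) : (List.finRange n).filter q = l := by
  have h1 : ((List.finRange n).filter q).Pairwise (· < ·) :=
    (List.pairwise_lt_finRange n).filter q
  refine List.Perm.eq_of_pairwise (fun a b _ _ h h' => absurd h h'.asymm) h1 hl ?_
  refine (List.perm_ext_iff_of_nodup (h1.imp fun h => h.ne) (hl.imp fun h => h.ne)).2 fun i => ?_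
  simp [h]

theorem arrivalPhase_eq (T : ℕ) (st : MQNet.State p.net.J p.net.N) (l : List (Fin p.net.N))
    (hl : (List.finRange p.net.N).filter (fun i => decide (p.net.hasArrival i T)) = l) :
    p.net.arrivalPhase T st = l.foldl (fun st i => p.net.tryAccept i st) st := by
  unfold MQNet.arrivalPhase
  rw [← hl, List.foldl_filter]
  simp

theorem Valid.arrivalPhase_of_ne (hp : p.Valid) (T : ℕ) (st : MQNet.State p.net.J p.net.N)
    (h : T % p.P ≠ p.H) :
    p.net.arrivalPhase T st = p.net.tryAccept (p.cls (4 + T % p.P)) st := by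
  have hP : 0 < p.P := hp.H_pos.trans hp.H_lt
  have hT := Nat.mod_lt T hP
  have hl : 4 + T % p.P < 2 * p.P + 4 := by omega
  refine arrivalPhase_eq T st [p.cls (4 + T % p.P)]
    (eq_filter_finRange (List.pairwise_singleton _ _) fun i => ?_)
  rw [List.mem_singleton, eq_cls_iff hl, decide_eq_true_iff, hp.hasArrival_iff]
  unfold delayN
  split_ifs <;> omega

theorem Valid.arrivalPhase_of_eq (hp : p.Valid) (T : ℕ) (st : MQNet.State p.net.J p.net.N)
    (h : T % p.P = p.H) :
    p.net.arrivalPhase T st = p.net.tryAccept (p.cls (4 + T % p.P))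
      (p.net.tryAccept (p.cls 3) (p.net.tryAccept (p.cls 2) st)) := by
  have hP : 0 < p.P := hp.H_pos.trans hp.H_lt
  have hT := Nat.mod_lt T hP
  have hl : 4 + T % p.P < 2 * p.P + 4 := by omega
  have h2 : 2 < 2 * p.P + 4 := by omega
  have h3 : 3 < 2 * p.P + 4 := by omega
  refine arrivalPhase_eq T st [p.cls 2, p.cls 3, p.cls (4 + T % p.P)]
    (eq_filter_finRange ?_ fun i => ?_)
  · simp only [List.pairwise_cons, List.mem_cons, List.not_mem_nil, or_false, Fin.lt_def,
      forall_eq_or_imp, forall_eq, val_cls hl, val_cls h2, val_cls h3]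
    simp
    omega
  · simp only [List.mem_cons, List.not_mem_nil, or_false, eq_cls_iff hl, eq_cls_iff h2,
      eq_cls_iff h3, decide_eq_true_iff, hp.hasArrival_iff]
    unfold delayN
    split_ifs <;> omega

theorem tryAccept_unbounded {l : ℕ} (hl : l < 4) (W : Fin (2 * p.P + 4) → ℕ)
    (C : Fin 3 → Option (Fin (2 * p.P + 4) × ℕ)) :
    p.net.tryAccept (p.cls l) (W, C) = (Function.update W (p.cls l) (W (p.cls l) + 1), C) := by
  have hc : p.net.cap (p.cls l) = none := by
    dsimp only [net]
    rw [val_cls (by omega), if_pos hl]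
  unfold MQNet.tryAccept
  rw [hc]

theorem tryAccept_blocker_zero :
    p.net.tryAccept (p.cls 2) (mkState τ w₀ w₁ b₀ b₁ e f c₀ c₁ c₂) =
      mkState τ w₀ w₁ (b₀ + 1) b₁ e f c₀ c₁ c₂ := by
  refine (tryAccept_unbounded (by omega) _ _).trans ?_
  rw [buf_two, update_buf_two]

theorem tryAccept_blocker_one :
    p.net.tryAccept (p.cls 3) (mkState τ w₀ w₁ b₀ b₁ e f c₀ c₁ c₂) =
      mkState τ w₀ w₁ b₀ (b₁ + 1) e f c₀ c₁ c₂ := by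
  refine (tryAccept_unbounded (by omega) _ _).trans ?_
  rw [buf_three, update_buf_three]

theorem tryAccept_counter_zero :
    p.net.tryAccept (p.cls 0) (mkState τ w₀ w₁ b₀ b₁ e f c₀ c₁ c₂) =
      mkState τ (w₀ + 1) w₁ b₀ b₁ e f c₀ c₁ c₂ := by
  refine (tryAccept_unbounded (by omega) _ _).trans ?_
  rw [buf_zero, update_buf_zero]

theorem tryAccept_counter_one :
    p.net.tryAccept (p.cls 1) (mkState τ w₀ w₁ b₀ b₁ e f c₀ c₁ c₂) =
      mkState τ w₀ (w₁ + 1) b₀ b₁ e f c₀ c₁ c₂ := by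
  refine (tryAccept_unbounded (by omega) _ _).trans ?_
  rw [buf_one, update_buf_one]

/-- State of the abstract interpreter of a slot program: waiting counter jobs, whether a counter
job is in service in the current cycle, and the pending jump (its slot and remaining time). -/
@[ext]
structure Config where
  w₀ : ℕ
  w₁ : ℕ
  k₀ : Bool
  k₁ : Bool
  jump : Option (ℕ × ℕ)

namespace Config

variable (p : SlotProgram)

/-- One unit of time for the pending jump. -/
def advance (A : Config) : Config :=
  match A.jump with
  | none => A
  | some (x, r) =>
    if r ≤ 1 then
      { A with
        w₀ := A.w₀ + if p.add x = 1 then 1 else 0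
        w₁ := A.w₁ + if p.add x = 2 then 1 else 0
        jump := none }
    else { A with jump := some (x, r - 1) }

/-- Decrement of the counters at the start of a cycle. -/
def begin (τ : ℕ) (A : Config) : Config :=
  if τ = 0 then
    { A with
      w₀ := A.w₀ - 1
      w₁ := A.w₁ - 1
      k₀ := decide (0 < A.w₀)
      k₁ := decide (0 < A.w₁) }
  else A

/-- Execution of slot `τ`. -/
def fire (τ : ℕ) (A : Config) : Config :=
  if A.jump = none ∧ (p.gate τ = 0 → A.k₀ = false) ∧ (p.gate τ = 1 → A.k₁ = false) then
    { A with jump := some (τ, p.dur τ) }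
  else A

/-- The interpreter during slot `τ`. -/
def tick (τ : ℕ) (A : Config) : Config := ((A.advance p).begin τ).fire p τ

/-- The service in progress at the server of a counter. -/
def counterService (i τ : ℕ) (k : Bool) : Option (Fin (2 * p.P + 4) × ℕ) :=
  if τ < p.H then if k then some (p.cls i, p.H - τ) else none else some (p.cls (2 + i), p.P - τ)

/-- The service in progress at the jump server. -/
def jumpServer (a : Option (ℕ × ℕ)) : Option (Fin (2 * p.P + 4) × ℕ) :=
  a.map fun y => (p.cls (4 + p.P + y.1), y.2)

/-- The network state encoding a configuration at the end of slot `τ`. -/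
def toState (τ : ℕ) (A : Config) : MQNet.State p.net.J p.net.N :=
  mkState τ A.w₀ A.w₁ 0 0 0 0 (counterService p 0 τ A.k₀) (counterService p 1 τ A.k₁)
    (jumpServer p A.jump)

/-- The network state encoding a configuration after the service completions of slot `τ`. -/
def toMidState (τ : ℕ) (A : Config) : MQNet.State p.net.J p.net.N :=
  mkState τ A.w₀ A.w₁ 0 0 0 0
    (if τ = 0 ∨ τ = p.H then none else counterService p 0 τ A.k₀)
    (if τ = 0 ∨ τ = p.H then none else counterService p 1 τ A.k₁)
    (jumpServer p A.jump)

/-- The invariant of the interpreter at the end of slot `τ`. -/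
structure Inv (τ : ℕ) (A : Config) : Prop where
  jump : ∀ x r, A.jump = some (x, r) →
    x < p.P ∧ 1 ≤ r ∧ (p.add x ≠ 0 → p.H ≤ τ + r ∧ τ + r < p.P)
  w₀ : τ < p.H → A.k₀ = false → A.w₀ = 0
  w₁ : τ < p.H → A.k₁ = false → A.w₁ = 0

/-- The invariant after the service completions of slot `τ`. -/
structure MidInv (τ : ℕ) (A : Config) : Prop where
  jump : ∀ x r, A.jump = some (x, r) →
    x < p.P ∧ 1 ≤ r ∧ (p.add x ≠ 0 → p.H ≤ τ + r ∧ τ + r < p.P)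
  w₀ : 0 < τ → τ < p.H → A.k₀ = false → A.w₀ = 0
  w₁ : 0 < τ → τ < p.H → A.k₁ = false → A.w₁ = 0

variable {p} {A : Config} {τ : ℕ}

theorem Inv.advance (hA : A.Inv p τ) (hτ : τ < p.P) :
    (A.advance p).MidInv p ((τ + 1) % p.P) := by
  have hlt : 0 < (τ + 1) % p.P → (τ + 1) % p.P = τ + 1 := fun h => by
    rcases Nat.lt_or_ge (τ + 1) p.P with h' | h'
    · exact Nat.mod_eq_of_lt h'
    · rw [show τ + 1 = p.P by omega, Nat.mod_self] at h
      omega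
  unfold Config.advance
  cases hj : A.jump with
  | none =>
    refine ⟨fun x r h => ?_, fun h0 h1 h2 => hA.w₀ ?_ h2, fun h0 h1 h2 => hA.w₁ ?_ h2⟩
    · exact absurd (hj.symm.trans h) (by simp)
    all_goals have := hlt h0; omega
  | some y =>
    obtain ⟨x, r⟩ := y
    obtain ⟨hx, hr, ha⟩ := hA.jump x r hj
    have hstep : p.add x ≠ 0 → (τ + 1) % p.P = τ + 1 := fun h => by
      have := ha h
      exact Nat.mod_eq_of_lt (by omega)
    dsimp only
    by_cases h1 : r ≤ 1
    · rw [if_pos h1]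
      refine ⟨fun x' r' h => by simp at h, fun h2 h3 h4 => ?_, fun h2 h3 h4 => ?_⟩
      · have h5 := hlt h2
        have h6 : p.add x ≠ 1 := fun h => by
          have := ha (by omega)
          omega
        simpa [h6] using hA.w₀ (by omega) h4
      · have h5 := hlt h2
        have h6 : p.add x ≠ 2 := fun h => by
          have := ha (by omega)
          omega
        simpa [h6] using hA.w₁ (by omega) h4
    · rw [if_neg h1]
      refine ⟨fun x' r' h => ?_, fun h2 h3 h4 => hA.w₀ ?_ h4, fun h2 h3 h4 => hA.w₁ ?_ h4⟩
      · obtain ⟨rfl, rfl⟩ := Prod.mk.inj (Option.some.inj h)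
        refine ⟨hx, by omega, fun h0 => ?_⟩
        have h2 := ha h0
        rw [hstep h0]
        omega
      · have := hlt h2
        omega
      · have := hlt h2
        omega

theorem MidInv.tick (hp : p.Valid) (hA : A.MidInv p τ) (hτ : τ < p.P) :
    ((A.begin τ).fire p τ).Inv p τ := by
  have hB : (A.begin τ).Inv p τ := by
    unfold Config.begin
    split_ifs with h
    · refine ⟨hA.jump, fun _ h2 => ?_, fun _ h2 => ?_⟩
      all_goals
        dsimp only at *
        simp only [decide_eq_false_iff_not] at h2
        omega
    · exact ⟨hA.jump, fun h1 => hA.w₀ (by omega) h1, fun h1 => hA.w₁ (by omega) h1⟩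
  unfold Config.fire
  split_ifs with h
  · refine ⟨fun x r h1 => ?_, hB.w₀, hB.w₁⟩
    obtain ⟨rfl, rfl⟩ := Prod.mk.inj (Option.some.inj h1)
    exact ⟨hτ, hp.dur_pos _ hτ, hp.add_range _ hτ⟩
  · exact hB

theorem Inv.tick (hp : p.Valid) (hA : A.Inv p τ) (hτ : τ < p.P) :
    (A.tick p ((τ + 1) % p.P)).Inv p ((τ + 1) % p.P) :=
  (hA.advance hτ).tick hp (Nat.mod_lt _ (hp.H_pos.trans hp.H_lt))

/-- The network performs one slot of the interpreter. -/
theorem MidInv.phases (hp : p.Valid) (T : ℕ) (hA : A.MidInv p (T % p.P)) :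
    p.net.microPhase (p.net.arrivalPhase T (A.toMidState p (T % p.P))) =
      ((A.begin (T % p.P)).fire p (T % p.P)).toState p (T % p.P) := by
  have hP : 0 < p.P := hp.H_pos.trans hp.H_lt
  have hH := hp.H_lt
  have hH0 := hp.H_pos
  have hτ := Nat.mod_lt T hP
  -- the state after the counters and blockers have started
  have hB := hA.tick hp hτ
  generalize hτT : T % p.P = τ at *
  set B := A.begin τ with hBdef
  have hBinv : B.w₀ = (B.fire p τ).w₀ ∧ B.w₁ = (B.fire p τ).w₁ ∧ B.k₀ = (B.fire p τ).k₀ ∧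
      B.k₁ = (B.fire p τ).k₁ := by
    unfold Config.fire
    split_ifs <;> exact ⟨rfl, rfl, rfl, rfl⟩
  have hBj : B.jump = A.jump := by
    rw [hBdef]
    unfold Config.begin
    split_ifs <;> rfl
  have h₀ : counterService p 0 τ B.k₀ = none → B.w₀ = 0 ∧ (0 : ℕ) = 0 := fun h => by
    unfold counterService at h
    split_ifs at h with h1 h2
    refine ⟨?_, rfl⟩
    rw [hBinv.1]
    exact hB.w₀ h1 (by rw [← hBinv.2.2.1]; simpa using h2)
  have h₁ : counterService p 1 τ B.k₁ = none → B.w₁ = 0 ∧ (0 : ℕ) = 0 := fun h => by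
    unfold counterService at h
    split_ifs at h with h1 h2
    refine ⟨?_, rfl⟩
    rw [hBinv.2.1]
    exact hB.w₁ h1 (by rw [← hBinv.2.2.2]; simpa using h2)
  have hfire : (B.fire p τ).toState p τ = mkState τ B.w₀ B.w₁ 0 0 0 0
      (counterService p 0 τ B.k₀) (counterService p 1 τ B.k₁)
      (jumpService p τ (counterService p 0 τ B.k₀) (counterService p 1 τ B.k₁)
        (jumpServer p B.jump)) := by
    unfold toState
    rw [← hBinv.1, ← hBinv.2.1, ← hBinv.2.2.1, ← hBinv.2.2.2]
    congr 3
    unfold jumpService Config.fire IsOpen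
    have hjn : jumpServer p B.jump = none ↔ B.jump = none := by simp [jumpServer]
    have hc : ∀ i, p.gate τ = i → i ≠ 2 → ∀ i' k,
        (counterService p i' τ k = none ↔ k = false) := fun i hi h i' k => by
      have := hp.gate_range τ (by omega)
      unfold counterService
      rw [if_pos this.2]
      simp
    have e1 : (p.gate τ = 0 → counterService p 0 τ B.k₀ = none) ↔ (p.gate τ = 0 → B.k₀ = false) :=
      forall_congr' fun h => hc _ h (by simp) _ _
    have e2 : (p.gate τ = 1 → counterService p 1 τ B.k₁ = none) ↔ (p.gate τ = 1 → B.k₁ = false) :=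
      forall_congr' fun h => hc _ h (by simp) _ _
    by_cases hb : B.jump = none ∧ (p.gate τ = 0 → B.k₀ = false) ∧ (p.gate τ = 1 → B.k₁ = false)
    · rw [if_pos hb, if_pos ⟨⟨e1.2 hb.2.1, e2.2 hb.2.2, fun _ => hjn.2 hb.1⟩, hjn.2 hb.1⟩]
      rfl
    · rw [if_neg hb, if_neg fun h => hb ⟨hjn.1 h.2, e1.1 h.1.1, e2.1 h.1.2.1⟩]
  rw [hfire]
  refine MQNet.Reaches.microPhase_eq ?_ (hp.micro_idle hτ h₀ h₁)
  have hgate : ∀ {τ'}, τ' = 0 ∨ p.H ≤ τ' → p.gate τ' = 2 := fun {τ'} h => by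
    by_contra hg
    have := hp.gate_range τ' hg
    omega
  -- whether the probe is accepted
  have hidle : ∀ {c₀ c₁ c₀' c₁' c₂ : Option (Fin (2 * p.P + 4) × ℕ)}, p.gate τ = 2 →
      (IsOpen p τ c₀ c₁ c₂ ↔ IsOpen p τ c₀' c₁' c₂) := fun h => by
    unfold IsOpen
    rw [h]
    simp
  rcases Nat.eq_zero_or_pos τ with h0 | hpos
  · have hg : p.gate τ = 2 := hgate (Or.inl h0)
    rw [hp.arrivalPhase_of_ne T _ (by omega), hτT]
    unfold toMidState
    rw [if_pos (Or.inl h0), if_pos (Or.inl h0), hp.tryAccept_probe hτ (by omega) (by omega)]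
    refine (hp.reaches_counters hτ hg).trans (l := 2) ?_
    have hc : ∀ {i w : ℕ}, (if 0 < w then some (p.cls i, p.H) else none) =
        counterService p i τ (decide (0 < w)) := fun {i w} => by
      simp [counterService, h0, hH0]
    have hB' : B = { A with
      w₀ := A.w₀ - 1
      w₁ := A.w₁ - 1
      k₀ := decide (0 < A.w₀)
      k₁ := decide (0 < A.w₁) } := by
      rw [hBdef]
      unfold Config.begin
      rw [if_pos h0]
    rw [hc, hc]
    rw [hB'] at h₀ h₁ ⊢
    exact hp.reaches_jump hτ h₀ h₁ (if_congr (hidle hg) rfl rfl)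
  · have hB' : B = A := by
      rw [hBdef]
      unfold Config.begin
      rw [if_neg (by omega)]
    rw [hB'] at h₀ h₁ ⊢
    unfold toMidState
    by_cases hHτ : τ = p.H
    · have hg : p.gate τ = 2 := hgate (by omega)
      rw [hp.arrivalPhase_of_eq T _ (by omega), hτT, if_pos (Or.inr hHτ), if_pos (Or.inr hHτ),
        tryAccept_blocker_zero, tryAccept_blocker_one,
        hp.tryAccept_probe hτ (by omega) (by omega)]
      refine (hp.reaches_blockers hτ hg).trans (l := 2) ?_
      have hc : ∀ {i k}, counterService p i τ k = some (p.cls (2 + i), p.P - p.H) :=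
        fun {i k} => by
          unfold counterService
          rw [if_neg (by omega), hHτ]
      rw [hc, hc] at *
      exact hp.reaches_jump hτ h₀ h₁ (if_congr (hidle hg) rfl rfl)
    · rw [hp.arrivalPhase_of_ne T _ (by omega), hτT, if_neg (by omega), if_neg (by omega),
        hp.tryAccept_probe hτ (fun _ => h₀) (fun _ => h₁)]
      exact (hp.reaches_jump hτ h₀ h₁ rfl).mono (by omega)

end Config

namespace Config

/-- One unit of service. -/
def serve {α : Type} : Option (α × ℕ) → Option (α × ℕ)
  | none => none
  | some (i, r) => if r ≤ 1 then none else some (i, r - 1)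

theorem _root_.MQNet.completionStep_of_none (net : MQNet) {st : MQNet.State net.J net.N}
    {j : Fin net.J} (h : st.2 j = none) : net.completionStep st j = st := by
  unfold MQNet.completionStep
  rw [h]

theorem _root_.MQNet.completionStep_of_le (net : MQNet) {st : MQNet.State net.J net.N}
    {j : Fin net.J} {i : Fin net.N} {r : ℕ} (h : st.2 j = some (i, r)) (hr : r ≤ 1) :
    net.completionStep st j = net.routeOne i (st.1, Function.update st.2 j none) := by
  unfold MQNet.completionStep
  rw [h]
  exact if_pos hr

theorem _root_.MQNet.completionStep_of_lt (net : MQNet) {st : MQNet.State net.J net.N}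
    {j : Fin net.J} {i : Fin net.N} {r : ℕ} (h : st.2 j = some (i, r)) (hr : ¬ r ≤ 1) :
    net.completionStep st j = (st.1, Function.update st.2 j (some (i, r - 1))) := by
  unfold MQNet.completionStep
  rw [h]
  exact if_neg hr

theorem completionStep_of_next (W : Fin p.net.N → ℕ) (C : Fin p.net.J → Option (Fin p.net.N × ℕ))
    (j : Fin p.net.J) (h : ∀ i r, C j = some (i, r) → p.net.next i = none) :
    p.net.completionStep (W, C) j = (W, Function.update C j (serve (C j))) := by
  rcases hc : C j with _ | ⟨i, r⟩
  · refine (p.net.completionStep_of_none hc).trans (congrArg (Prod.mk W) ?_)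
    exact ((congrArg _ hc.symm).trans (Function.update_eq_self j C)).symm
  · by_cases h1 : r ≤ 1
    · have h2 : serve (some (i, r)) = none := if_pos h1
      refine (p.net.completionStep_of_le hc h1).trans ?_
      unfold MQNet.routeOne
      rw [h i r hc, h2]
    · have h2 : serve (some (i, r)) = some (i, r - 1) := if_neg h1
      rw [h2]
      exact p.net.completionStep_of_lt hc h1

theorem next_cls_of_lt {c : ℕ} (h : c < 4) : p.net.next (p.cls c) = none := by
  dsimp only [net]
  rw [val_cls (by omega), if_pos (by simp [nextN, h])]

theorem next_of_counterService {i τ r : ℕ} {k : Bool} {c : Fin (2 * p.P + 4)} (hi : i < 2)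
    (h : counterService p i τ k = some (c, r)) : p.net.next c = none := by
  unfold counterService at h
  split_ifs at h
  all_goals
    obtain ⟨rfl, -⟩ := Prod.mk.inj (Option.some.inj h)
    exact next_cls_of_lt (by omega)

theorem serve_counterService (hp : p.Valid) {i τ : ℕ} {k : Bool} (hτ : τ < p.P) :
    serve (counterService p i τ k) = if (τ + 1) % p.P = 0 ∨ (τ + 1) % p.P = p.H then none else
      counterService p i ((τ + 1) % p.P) k := by
  have hH := hp.H_lt
  have hH0 := hp.H_pos
  unfold counterService
  rcases Nat.lt_or_ge τ p.H with h | h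
  · rw [if_pos h, Nat.mod_eq_of_lt (show τ + 1 < p.P by omega)]
    cases k
    · simp only [Bool.false_eq_true, if_false]
      split_ifs <;> first | rfl | omega
    · simp only [if_true, serve]
      by_cases h1 : τ + 1 = p.H
      · rw [if_pos (by omega), if_pos (by omega)]
      · rw [if_neg (by omega), if_neg (by omega), if_pos (by omega)]
        rfl
  · rw [if_neg (by omega)]
    simp only [serve]
    rcases Nat.lt_or_ge (τ + 1) p.P with h1 | h1
    · rw [Nat.mod_eq_of_lt h1, if_neg (by omega), if_neg (by omega), if_neg (by omega)]
      rfl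
    · rw [show τ + 1 = p.P by omega, Nat.mod_self, if_pos (by omega), if_pos (Or.inl rfl)]

theorem buf_eq_buf {τ τ' w₀ w₁ : ℕ} :
    buf (p := p) τ w₀ w₁ 0 0 0 0 = buf τ' w₀ w₁ 0 0 0 0 := by
  funext i
  simp only [buf, ite_self]

variable {A : Config} {τ : ℕ}

theorem completionStep_jump (hp : p.Valid) (hA : A.Inv p τ) {w₀ w₁ : ℕ}
    {c₀ c₁ : Option (Fin (2 * p.P + 4) × ℕ)} (h₀ : A.w₀ = w₀) (h₁ : A.w₁ = w₁) :
    p.net.completionStep (mkState τ w₀ w₁ 0 0 0 0 c₀ c₁ (jumpServer p A.jump)) (2 : Fin 3) =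
      mkState τ (A.advance p).w₀ (A.advance p).w₁ 0 0 0 0 c₀ c₁
        (jumpServer p (A.advance p).jump) := by
  subst h₀ h₁
  rcases hj : A.jump with _ | ⟨x, r⟩
  · have h : A.advance p = A := by
      unfold Config.advance
      rw [hj]
    rw [h, hj]
    exact p.net.completionStep_of_none rfl
  · obtain ⟨hx, hr, ha⟩ := hA.jump x r hj
    by_cases h1 : r ≤ 1
    · refine (p.net.completionStep_of_le rfl h1).trans ?_
      have hn : p.nextN (p.cls (4 + p.P + x) : ℕ) = p.add x := by
        rw [val_cls (by omega)]
        unfold nextN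
        rw [if_neg (by omega), if_neg (by omega), show 4 + p.P + x - (4 + p.P) = x by omega]
      have h3 := hp.add_le x
      have hd : A.advance p = { A with
          w₀ := A.w₀ + if p.add x = 1 then 1 else 0
          w₁ := A.w₁ + if p.add x = 2 then 1 else 0
          jump := none } := by
        unfold Config.advance
        rw [hj]
        exact if_pos h1
      rw [hd]
      unfold MQNet.routeOne
      dsimp only [net]
      rw [hn, update_server_two]
      interval_cases h4 : p.add x
      · rfl
      · exact tryAccept_counter_zero
      · exact tryAccept_counter_one
    · refine (p.net.completionStep_of_lt rfl h1).trans ?_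
      have hd : A.advance p = { A with jump := some (x, r - 1) } := by
        unfold Config.advance
        rw [hj]
        exact if_neg h1
      rw [hd]
      exact congrArg _ (update_server_two _)

theorem Inv.completionPhase (hp : p.Valid) (hA : A.Inv p τ) (hτ : τ < p.P) :
    p.net.completionPhase (A.toState p τ) = (A.advance p).toMidState p ((τ + 1) % p.P) := by
  have hk : (A.advance p).k₀ = A.k₀ ∧ (A.advance p).k₁ = A.k₁ := by
    unfold Config.advance
    split
    · exact ⟨rfl, rfl⟩
    · split_ifs <;> exact ⟨rfl, rfl⟩
  have hl : List.finRange p.net.J = [(0 : Fin 3), (1 : Fin 3), (2 : Fin 3)] :=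
    show List.finRange 3 = _ by decide
  unfold MQNet.completionPhase toMidState toState
  rw [hl, hk.1, hk.2, ← serve_counterService hp hτ, ← serve_counterService hp hτ]
  simp only [List.foldl_cons, List.foldl_nil]
  have e0 : p.net.completionStep (mkState τ A.w₀ A.w₁ 0 0 0 0 (counterService p 0 τ A.k₀)
      (counterService p 1 τ A.k₁) (jumpServer p A.jump)) (0 : Fin 3) =
      mkState τ A.w₀ A.w₁ 0 0 0 0 (serve (counterService p 0 τ A.k₀))
        (counterService p 1 τ A.k₁) (jumpServer p A.jump) := by
    rw [completionStep_of_next]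
    · exact congrArg _ (update_server_zero _)
    · exact fun i r h => next_of_counterService (by omega) h
  have e1 : p.net.completionStep (mkState τ A.w₀ A.w₁ 0 0 0 0 (serve (counterService p 0 τ A.k₀))
      (counterService p 1 τ A.k₁) (jumpServer p A.jump)) (1 : Fin 3) =
      mkState τ A.w₀ A.w₁ 0 0 0 0 (serve (counterService p 0 τ A.k₀))
        (serve (counterService p 1 τ A.k₁)) (jumpServer p A.jump) := by
    rw [completionStep_of_next]
    · exact congrArg _ (update_server_one _)
    · exact fun i r h => next_of_counterService (by omega) h
  rw [e0, e1, completionStep_jump hp hA rfl rfl]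
  exact congrArg (·, _) buf_eq_buf

variable (p) in
/-- The run of the interpreter from empty counters. -/
def run : ℕ → Config
  | 0 => (Config.begin 0 ⟨0, 0, false, false, none⟩).fire p 0
  | T + 1 => (run T).tick p ((T + 1) % p.P)

theorem midInv_empty : MidInv p 0 ⟨0, 0, false, false, none⟩ :=
  ⟨fun _ _ h => absurd h (by simp), fun h => absurd h (by simp), fun h => absurd h (by simp)⟩

theorem run_inv (hp : p.Valid) (T : ℕ) : (run p T).Inv p (T % p.P) := by
  have hP : 0 < p.P := hp.H_pos.trans hp.H_lt
  induction T with
  | zero =>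
    rw [Nat.zero_mod]
    exact midInv_empty.tick hp hP
  | succ T ih =>
    have := ih.tick hp (Nat.mod_lt _ hP)
    rwa [Nat.mod_add_mod] at this

theorem stateAt_eq (hp : p.Valid) (T : ℕ) :
    p.net.stateAt (fun _ => 0) T = (run p T).toState p (T % p.P) := by
  have hP : 0 < p.P := hp.H_pos.trans hp.H_lt
  induction T with
  | zero =>
    have h0 : (((fun _ => 0, fun _ => none) : MQNet.State p.net.J p.net.N)) =
        toMidState p 0 ⟨0, 0, false, false, none⟩ := by
      refine Prod.ext ?_ ?_
      · funext i
        simp [toMidState, buf]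
      · funext j
        fin_cases j <;> simp [toMidState, jumpServer]
    have h1 : p.net.completionPhase (toMidState p 0 ⟨0, 0, false, false, none⟩) =
        toMidState p 0 ⟨0, 0, false, false, none⟩ := by
      rw [← h0]
      unfold MQNet.completionPhase
      induction List.finRange p.net.J with
      | nil => rfl
      | cons j l ih => exact ih
    have h2 := MidInv.phases hp 0 (A := ⟨0, 0, false, false, none⟩)
    rw [Nat.zero_mod] at h2 ⊢
    unfold MQNet.stateAt MQNet.step
    rw [h0, h1, h2 midInv_empty]
    rfl
  | succ T ih =>
    have hinv := run_inv hp T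
    have h2 := MidInv.phases hp (T + 1) (A := (run p T).advance p)
    have h3 := hinv.advance (Nat.mod_lt _ hP)
    unfold MQNet.stateAt MQNet.step
    rw [ih, hinv.completionPhase hp (Nat.mod_lt _ hP)]
    rw [Nat.mod_add_mod] at *
    rw [h2 h3]
    rfl

end Config

namespace Config

/-- The interpreter reaches slot `τ` of cycle `n` with no pending jump, the given waiting counter
jobs and the given results of the counter tests. -/
def At (p : SlotProgram) (n τ w₀ w₁ : ℕ) (k₀ k₁ : Bool) : Prop :=
  run p (n * p.P + τ) = fire p τ ⟨w₀, w₁, k₀, k₁, none⟩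

variable {n τ x r : ℕ} {k₀ k₁ : Bool}

theorem run_succ (hτ : τ + 1 < p.P) : run p (n * p.P + (τ + 1)) =
    ((run p (n * p.P + τ)).advance p).fire p (τ + 1) := by
  have h : (n * p.P + τ + 1) % p.P = τ + 1 := by
    rw [add_assoc, mul_comm, Nat.mul_add_mod, Nat.mod_eq_of_lt hτ]
  rw [← add_assoc, run, tick, h]
  unfold begin
  rw [if_neg (by omega)]

theorem run_add (hr : τ + (r + 1) < p.P)
    (h : run p (n * p.P + τ) = ⟨w₀, w₁, k₀, k₁, some (x, r + 1)⟩) :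
    At p n (τ + (r + 1)) (w₀ + if p.add x = 1 then 1 else 0) (w₁ + if p.add x = 2 then 1 else 0)
      k₀ k₁ := by
  induction r generalizing τ with
  | zero =>
    unfold At
    rw [zero_add, run_succ hr, h]
    rfl
  | succ r ih =>
    have h1 := ih (τ := τ + 1) (by omega) (by
      rw [run_succ (by omega), h]
      rfl)
    rwa [show τ + 1 + (r + 1) = τ + (r + 1 + 1) by omega] at h1

theorem run_wrap (hτ : τ < p.P) (hr : p.P < τ + r)
    (h : run p (n * p.P + τ) = ⟨w₀, w₁, k₀, k₁, some (x, r)⟩) :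
    run p ((n + 1) * p.P) =
      ⟨w₀ - 1, w₁ - 1, decide (0 < w₀), decide (0 < w₁), some (x, r - (p.P - τ))⟩ := by
  obtain ⟨d, hd⟩ : ∃ d, p.P = τ + d + 1 := ⟨p.P - τ - 1, by omega⟩
  have hadv : ∀ {r : ℕ}, 1 < r →
      Config.advance p ⟨w₀, w₁, k₀, k₁, some (x, r)⟩ = ⟨w₀, w₁, k₀, k₁, some (x, r - 1)⟩ :=
    fun h => if_neg (by omega)
  induction d generalizing τ r with
  | zero =>
    have h1 : (n + 1) * p.P = n * p.P + τ + 1 := by rw [add_mul]; omega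
    rw [h1, run, h, tick, ← h1, Nat.mul_mod_left, hadv (by omega),
      show r - (p.P - τ) = r - 1 by omega]
    rfl
  | succ d ih =>
    have h1 := ih (τ := τ + 1) (r := r - 1) (by omega) (by omega) (by
      rw [run_succ (by omega), h, hadv (by omega)]
      rfl) (by omega)
    rwa [show r - 1 - (p.P - (τ + 1)) = r - (p.P - τ) by omega] at h1

theorem At.jump (h : At p n τ w₀ w₁ k₀ k₁) (h₀ : p.gate τ = 0 → k₀ = false)
    (h₁ : p.gate τ = 1 → k₁ = false) (hd : 0 < p.dur τ) (hlt : τ + p.dur τ < p.P) :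
    At p n (τ + p.dur τ) (w₀ + if p.add τ = 1 then 1 else 0)
      (w₁ + if p.add τ = 2 then 1 else 0) k₀ k₁ := by
  obtain ⟨r, hr⟩ := Nat.exists_eq_add_of_lt hd
  rw [zero_add] at hr
  rw [hr] at hlt ⊢
  refine run_add hlt (h.trans ?_)
  rw [← hr]
  exact if_pos ⟨rfl, h₀, h₁⟩

theorem At.skip_zero (h : At p n τ w₀ w₁ true k₁) (h₀ : p.gate τ = 0) (hlt : τ + 1 < p.P) :
    At p n (τ + 1) w₀ w₁ true k₁ := by
  have h1 : fire p τ ⟨w₀, w₁, true, k₁, none⟩ = ⟨w₀, w₁, true, k₁, none⟩ :=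
    if_neg fun h => absurd (h.2.1 h₀) (by simp)
  unfold At at *
  rw [run_succ hlt, h, h1]
  rfl

theorem At.skip_one (h : At p n τ w₀ w₁ k₀ true) (h₁ : p.gate τ = 1) (hlt : τ + 1 < p.P) :
    At p n (τ + 1) w₀ w₁ k₀ true := by
  have h1 : fire p τ ⟨w₀, w₁, k₀, true, none⟩ = ⟨w₀, w₁, k₀, true, none⟩ :=
    if_neg fun h => absurd (h.2.2 h₁) (by simp)
  unfold At at *
  rw [run_succ hlt, h, h1]
  rfl

theorem At.wrap (h : At p n τ w₀ w₁ k₀ k₁) (hg : p.gate τ = 2) (hτ : τ < p.P)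
    (hlt : p.P < τ + p.dur τ) :
    run p ((n + 1) * p.P) = ⟨w₀ - 1, w₁ - 1, decide (0 < w₀), decide (0 < w₁),
      some (τ, p.dur τ - (p.P - τ))⟩ :=
  run_wrap hτ hlt (h.trans (if_pos ⟨rfl, fun h => by omega, fun h => by omega⟩))

end Config

/-- The slot program of a two-counter machine with `m` states and initial state `s₀`. The index
`y = 4 s + 2 b₀ + b₁` stands for state `s` and test results `b₀, b₁`, and `G y` consists of the new
state and, for each counter, of the number of jobs to be added to compensate for the
decrement at the start of each cycle. The slots form seven pages of length `4 m`. -/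
def machine (m s₀ : ℕ) (G : ℕ → ℕ × ℕ × ℕ) : SlotProgram where
  P := 28 * m
  H := 12 * m
  gate x :=
    if x / (4 * m) = 1 ∧ x % 4 = 0 then 0 else if x / (4 * m) = 2 ∧ x % 2 = 0 then 1 else 2
  dur x :=
    if x / (4 * m) = 0 then 4 * m + 4 * s₀ - x else
      if x / (4 * m) = 6 then 32 * m + 4 * (G (x % (4 * m))).1 - x else
        if x / (4 * m) = 1 ∧ x % 4 ≠ 0 then 4 * m + 1 else 4 * m
  add x :=
    if x / (4 * m) = 2 ∧ 1 ≤ (G (x % (4 * m))).2.1 ∨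
        x / (4 * m) = 3 ∧ 2 ≤ (G (x % (4 * m))).2.1 then 1 else
      if x / (4 * m) = 4 ∧ 1 ≤ (G (x % (4 * m))).2.2 ∨
        x / (4 * m) = 5 ∧ 2 ≤ (G (x % (4 * m))).2.2 then 2 else 0

theorem machine_valid {m s₀ : ℕ} {G : ℕ → ℕ × ℕ × ℕ} (hm : 0 < m) : (machine m s₀ G).Valid := by
  have hdiv : ∀ x, 4 * m * (x / (4 * m)) ≤ x ∧ x < 4 * m * (x / (4 * m)) + 4 * m := fun x =>
    ⟨Nat.mul_div_le x _, Nat.lt_mul_div_succ x (by omega)⟩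
  refine ⟨by simp only [machine]; omega, by simp only [machine]; omega, fun x => ?_, fun x h => ?_,
    fun x hx => ?_, fun x => ?_, fun x hx h => ?_⟩
  all_goals
    obtain ⟨h1, h2⟩ := hdiv x
    simp only [machine] at *
    generalize x / (4 * m) = c at *
  · split_ifs <;> omega
  · split_ifs at h with h3 h4
    · obtain ⟨rfl, -⟩ := h3
      omega
    · obtain ⟨rfl, -⟩ := h4
      omega
    · omega
  · split_ifs with h3 h4 h5
    · subst h3
      omega
    · omega
    · omega
    · omega
  · split_ifs <;> omega
  · have hc : c = 2 ∨ c = 3 ∨ c = 4 ∨ c = 5 := by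
      split_ifs at h <;> omega
    rw [if_neg (by omega), if_neg (by omega), if_neg (by omega)]
    rcases hc with rfl | rfl | rfl | rfl <;> omega

section Machine

variable {m s₀ c y : ℕ} {G : ℕ → ℕ × ℕ × ℕ}

theorem page_div (h : y < 4 * m) : (4 * m * c + y) / (4 * m) = c := by
  rw [Nat.mul_add_div (by omega), Nat.div_eq_of_lt h, add_zero]

theorem page_mod (h : y < 4 * m) : (4 * m * c + y) % (4 * m) = y := by
  rw [Nat.mul_add_mod, Nat.mod_eq_of_lt h]

theorem page_mod_four : (4 * m * c + y) % 4 = y % 4 := by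
  rw [mul_assoc, Nat.mul_add_mod]

theorem page_mod_two : (4 * m * c + y) % 2 = y % 2 := by
  rw [show 4 * m * c = 2 * (2 * m * c) by ring, Nat.mul_add_mod]

theorem machine_gate (h : y < 4 * m) : (machine m s₀ G).gate (4 * m * c + y) =
    if c = 1 ∧ y % 4 = 0 then 0 else if c = 2 ∧ y % 2 = 0 then 1 else 2 := by
  simp only [machine, page_div h, page_mod_four, page_mod_two]

theorem machine_dur (h : y < 4 * m) : (machine m s₀ G).dur (4 * m * c + y) =
    if c = 0 then 4 * m + 4 * s₀ - y else
      if c = 6 then 8 * m + 4 * (G y).1 - y else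
        if c = 1 ∧ y % 4 ≠ 0 then 4 * m + 1 else 4 * m := by
  simp only [machine, page_div h, page_mod_four, page_mod h]
  split_ifs with h1 h2
  · subst h1
    omega
  · subst h2
    omega
  · rfl
  · rfl

theorem machine_add (h : y < 4 * m) : (machine m s₀ G).add (4 * m * c + y) =
    if c = 2 ∧ 1 ≤ (G y).2.1 ∨ c = 3 ∧ 2 ≤ (G y).2.1 then 1 else
      if c = 4 ∧ 1 ≤ (G y).2.2 ∨ c = 5 ∧ 2 ≤ (G y).2.2 then 2 else 0 := by
  simp only [machine, page_div h, page_mod h]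

open Config

variable {n s w₀ w₁ : ℕ} {k₀ k₁ : Bool}

/-- The index of a state together with the results of the tests of the counters. -/
def index (s : ℕ) (k₀ k₁ : Bool) : ℕ := 4 * s + 2 * k₀.toNat + k₁.toNat

theorem index_lt (hs : s < m) : index s k₀ k₁ < 4 * m := by
  unfold index
  cases k₀ <;> cases k₁ <;> simp <;> omega

theorem machine_jump (hy : y < 4 * m) (hc : 1 ≤ c ∧ c ≤ 5)
    (h : At (machine m s₀ G) n (4 * m * c + y) w₀ w₁ k₀ k₁)
    (h₀ : c = 1 → y % 4 = 0 → k₀ = false) (h₁ : c = 2 → y % 2 = 0 → k₁ = false) :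
    At (machine m s₀ G) n (4 * m * (c + 1) + (y + if c = 1 ∧ y % 4 ≠ 0 then 1 else 0))
      (w₀ + if c = 2 ∧ 1 ≤ (G y).2.1 ∨ c = 3 ∧ 2 ≤ (G y).2.1 then 1 else 0)
      (w₁ + if c = 4 ∧ 1 ≤ (G y).2.2 ∨ c = 5 ∧ 2 ≤ (G y).2.2 then 1 else 0) k₀ k₁ := by
  have hP : (machine m s₀ G).P = 28 * m := rfl
  have hd : (machine m s₀ G).dur (4 * m * c + y) =
      4 * m + if c = 1 ∧ y % 4 ≠ 0 then 1 else 0 := by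
    rw [machine_dur hy, if_neg (by omega), if_neg (by omega)]
    split_ifs <;> rfl
  have hlt : 4 * m * c + y + (machine m s₀ G).dur (4 * m * c + y) < (machine m s₀ G).P := by
    rw [hd, hP]
    obtain ⟨hc₁, hc₅⟩ := hc
    interval_cases c <;> split_ifs <;> omega
  have hgate : ∀ i < 2, (machine m s₀ G).gate (4 * m * c + y) = i →
      i = 0 ∧ c = 1 ∧ y % 4 = 0 ∨ i = 1 ∧ c = 2 ∧ y % 2 = 0 := fun i hi h => by
    rw [machine_gate hy] at h
    split_ifs at h <;> omega
  have h1 := h.jump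
    (fun h => by obtain h | h := hgate 0 (by omega) h <;> [exact h₀ h.2.1 h.2.2; omega])
    (fun h => by obtain h | h := hgate 1 (by omega) h <;> [omega; exact h₁ h.2.1 h.2.2])
    (by rw [hd]; omega) hlt
  have e0 : (machine m s₀ G).add (4 * m * c + y) = 1 ↔
      c = 2 ∧ 1 ≤ (G y).2.1 ∨ c = 3 ∧ 2 ≤ (G y).2.1 := by
    rw [machine_add hy]
    split_ifs <;> simp_all
  have e1 : (machine m s₀ G).add (4 * m * c + y) = 2 ↔
      c = 4 ∧ 1 ≤ (G y).2.2 ∨ c = 5 ∧ 2 ≤ (G y).2.2 := by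
    rw [machine_add hy]
    split_ifs <;> [omega; simp_all; simp_all]
  simp only [e0, e1, hd] at h1
  convert h1 using 1
  ring

theorem machine_test_zero (hs : s < m)
    (h : At (machine m s₀ G) n (4 * m * 1 + 4 * s) w₀ w₁ k₀ k₁) :
    At (machine m s₀ G) n (4 * m * 2 + (4 * s + 2 * k₀.toNat)) w₀ w₁ k₀ k₁ := by
  have hP : (machine m s₀ G).P = 28 * m := rfl
  have h4 : 4 * s % 4 = 0 := by omega
  cases k₀
  · simpa [h4] using machine_jump (by omega) (by omega) h (fun _ _ => rfl) (by omega)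
  · have h0 := h.skip_zero (by rw [machine_gate (by omega), if_pos ⟨rfl, h4⟩]) (by omega)
    rw [add_assoc] at h0
    have h5 : (4 * s + 1) % 4 = 1 := by omega
    simpa [h5] using machine_jump (by omega) (by omega) h0 (by omega) (by omega)

theorem machine_test_one (hs : s < m)
    (h : At (machine m s₀ G) n (4 * m * 2 + (4 * s + 2 * k₀.toNat)) w₀ w₁ k₀ k₁) :
    At (machine m s₀ G) n (4 * m * 3 + index s k₀ k₁)
      (w₀ + if 1 ≤ (G (index s k₀ k₁)).2.1 then 1 else 0) w₁ k₀ k₁ := by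
  have hP : (machine m s₀ G).P = 28 * m := rfl
  have hy := index_lt (k₀ := k₀) (k₁ := k₁) hs
  have h1 : At (machine m s₀ G) n (4 * m * 2 + index s k₀ k₁) w₀ w₁ k₀ k₁ := by
    cases k₁
    · exact h
    · refine h.skip_one ?_ ?_
      · rw [machine_gate, if_neg (by omega), if_pos ⟨rfl, by omega⟩]
        exact (Nat.le_add_right _ _).trans_lt hy
      · unfold index at hy
        simp only [Bool.toNat_true] at hy
        omega
  have h2 := machine_jump hy (by omega) h1 (by omega) (fun _ h => by
    unfold index at h
    cases k₁
    · rfl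
    · simp only [Bool.toNat_true] at h
      omega)
  simpa using h2

/-- At the start of cycle `n`, the interpreter holds the counters `z₀, z₁` and state `s`. -/
def Encodes (p : SlotProgram) (m n s z₀ z₁ : ℕ) : Prop :=
  ∃ x, p.add x = 0 ∧ run p (n * p.P) =
    ⟨z₀ - 1, z₁ - 1, decide (0 < z₀), decide (0 < z₁), some (x, 4 * m + 4 * s)⟩

/-- One cycle of the program simulates one step of the machine. -/
theorem machine_cycle {z₀ z₁ : ℕ} {k₀ k₁ : Bool} (hs : s < m) (hk₀ : k₀ = decide (0 < z₀))
    (hk₁ : k₁ = decide (0 < z₁))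
    (hG₀ : (G (index s k₀ k₁)).2.1 ≤ 2) (hG₁ : (G (index s k₀ k₁)).2.2 ≤ 2)
    (h : Encodes (machine m s₀ G) m n s z₀ z₁) :
    Encodes (machine m s₀ G) m (n + 1) (G (index s k₀ k₁)).1
      (z₀ - 1 + (G (index s k₀ k₁)).2.1) (z₁ - 1 + (G (index s k₀ k₁)).2.2) := by
  have hP : (machine m s₀ G).P = 28 * m := rfl
  have hy := index_lt (k₀ := k₀) (k₁ := k₁) hs
  obtain ⟨x, hx, h⟩ := h
  rw [← hk₀, ← hk₁] at h
  have h1 : At (machine m s₀ G) n (4 * m * 1 + 4 * s) (z₀ - 1) (z₁ - 1) k₀ k₁ := by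
    obtain ⟨r, hr⟩ : ∃ r, 4 * m + 4 * s = r + 1 := ⟨4 * m + 4 * s - 1, by omega⟩
    rw [hr] at h
    have h2 := run_add (τ := 0) (by omega) h
    simpa [hx, hr] using h2
  have h3 := machine_test_one hs (machine_test_zero hs h1)
  generalize index s k₀ k₁ = y at *
  have h4 := machine_jump hy (by omega) h3 (by omega) (by omega)
  simp at h4
  have h5 := machine_jump hy (by omega) h4 (by omega) (by omega)
  simp at h5
  have h6 := machine_jump hy (by omega) h5 (by omega) (by omega)
  simp at h6
  have hd := machine_dur (s₀ := s₀) (c := 6) (G := G) hy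
  rw [if_neg (by omega), if_pos rfl] at hd
  have h7 := h6.wrap (by rw [machine_gate hy]; simp) (by omega) (by omega)
  refine ⟨4 * m * 6 + y, by rw [machine_add hy]; simp, ?_⟩
  have e : ∀ {w A : ℕ}, A ≤ 2 → (w + if 1 ≤ A then 1 else 0) + (if 2 ≤ A then 1 else 0) = w + A :=
    fun h => by split_ifs <;> omega
  rw [e hG₀, e hG₁, hd, show 8 * m + 4 * (G y).1 - y - ((machine m s₀ G).P - (4 * m * 6 + y)) =
    4 * m + 4 * (G y).1 by omega] at h7
  exact h7

end Machine

namespace Config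

variable {A : Config}

theorem sum_buf : ∑ i, buf (p := p) τ w₀ w₁ 0 0 0 0 i = w₀ + w₁ := by
  have h : ∀ i, buf (p := p) τ w₀ w₁ 0 0 0 0 i =
      (if i = p.cls 0 then w₀ else 0) + (if i = p.cls 1 then w₁ else 0) := fun i => by
    simp only [eq_cls_iff (show 0 < 2 * p.P + 4 by omega),
      eq_cls_iff (show 1 < 2 * p.P + 4 by omega)]
    unfold buf
    split_ifs <;> omega
  simp [h, Finset.sum_add_distrib]

theorem totalQ_toState : p.net.totalQ (A.toState p τ) = A.w₀ + A.w₁ +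
    ((if (counterService p 0 τ A.k₀).isSome then 1 else 0) +
      (if (counterService p 1 τ A.k₁).isSome then 1 else 0) +
      (if (jumpServer p A.jump).isSome then 1 else 0)) := by
  unfold MQNet.totalQ toState
  refine congrArg₂ _ sum_buf ((Finset.card_filter _ _).trans ?_)
  exact Fin.sum_univ_three _

theorem totalQ_toState_le : p.net.totalQ (A.toState p τ) ≤ A.w₀ + A.w₁ + 3 := by
  rw [totalQ_toState]
  split_ifs <;> omega

theorem le_totalQ_toState (hp : p.Valid) {z₀ z₁ : ℕ} (h₀ : A.w₀ = z₀ - 1) (h₁ : A.w₁ = z₁ - 1)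
    (hk₀ : A.k₀ = decide (0 < z₀)) (hk₁ : A.k₁ = decide (0 < z₁)) :
    z₀ + z₁ ≤ p.net.totalQ (A.toState p 0) := by
  rw [totalQ_toState]
  unfold counterService
  rw [if_pos hp.H_pos, if_pos hp.H_pos, hk₀, hk₁, h₀, h₁]
  by_cases g₀ : 0 < z₀ <;> by_cases g₁ : 0 < z₁ <;> simp [g₀, g₁] <;> omega

theorem tick_le : (A.tick p τ).w₀ + (A.tick p τ).w₁ ≤ A.w₀ + A.w₁ + 1 := by
  have h1 : ∀ B : Config, (B.fire p τ).w₀ + (B.fire p τ).w₁ ≤ B.w₀ + B.w₁ := fun B => by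
    unfold fire
    split_ifs <;> exact le_rfl
  have h2 : ∀ B : Config, (B.begin τ).w₀ + (B.begin τ).w₁ ≤ B.w₀ + B.w₁ := fun B => by
    unfold begin
    split_ifs
    · dsimp only
      omega
    · exact le_rfl
  have h3 : (A.advance p).w₀ + (A.advance p).w₁ ≤ A.w₀ + A.w₁ + 1 := by
    unfold advance
    split
    · omega
    · split_ifs <;> dsimp only <;> omega
  exact (h1 _).trans ((h2 _).trans h3)

theorem run_add_le (T d : ℕ) :
    (run p (T + d)).w₀ + (run p (T + d)).w₁ ≤ (run p T).w₀ + (run p T).w₁ + d := by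
  induction d with
  | zero => exact le_rfl
  | succ d ih => exact tick_le.trans (Nat.add_le_add_right ih 1)

end Config

section Machine

variable {m s₀ : ℕ} {G : ℕ → ℕ × ℕ × ℕ} {Γ : Fin m → Bool → Bool → Fin m × ℤ × ℤ}

open Config

/-- `G` is the table of the transition function `Γ`. -/
def IsTable (Γ : Fin m → Bool → Bool → Fin m × ℤ × ℤ) (G : ℕ → ℕ × ℕ × ℕ) : Prop :=
  ∀ (s : Fin m) (b₀ b₁ : Bool), G (index s b₀ b₁) = ((Γ s b₀ b₁).1.val,
    ((Γ s b₀ b₁).2.1 + (b₀.toNat : ℤ)).toNat, ((Γ s b₀ b₁).2.2 + (b₁.toNat : ℤ)).toNat)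

theorem encodes_traj (hΓ : CM.Valid Γ) (hG : IsTable Γ G) (sstar : Fin m) (n : ℕ) :
    Encodes (machine m sstar G) m n (CM.traj Γ (sstar, 0, 0) n).1
      (CM.traj Γ (sstar, 0, 0) n).2.1 (CM.traj Γ (sstar, 0, 0) n).2.2 := by
  have hm : 0 < m := sstar.pos
  induction n with
  | zero =>
    have h := machine_add (m := m) (s₀ := sstar) (c := 0) (y := 0) (G := G) (by omega)
    have hd := machine_dur (m := m) (s₀ := sstar) (c := 0) (y := 0) (G := G) (by omega)
    have hg := machine_gate (m := m) (s₀ := sstar) (c := 0) (y := 0) (G := G) (by omega)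
    simp only [Nat.mul_zero, Nat.add_zero] at h hd hg
    refine ⟨0, by rw [h]; simp, ?_⟩
    rw [Nat.zero_mul]
    refine (if_pos ⟨rfl, fun _ => rfl, fun _ => rfl⟩).trans ?_
    rw [hd]
    rfl
  | succ n ih =>
    have hstep : CM.traj Γ (sstar, 0, 0) (n + 1) = CM.step Γ (CM.traj Γ (sstar, 0, 0) n) :=
      Function.iterate_succ_apply' _ _ _
    rw [hstep]
    generalize CM.traj Γ (sstar, 0, 0) n = C at ih ⊢
    obtain ⟨s, z₀, z₁⟩ := C
    unfold CM.step
    dsimp only at ih ⊢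
    have hD := hΓ.1 s (decide (0 < z₀)) (decide (0 < z₁))
    have h := machine_cycle s.isLt rfl rfl (G := G) (z₀ := z₀) (z₁ := z₁) (n := n)
      (s₀ := sstar) (m := m)
    rw [hG] at h
    generalize Γ s (decide (0 < z₀)) (decide (0 < z₁)) = R at *
    obtain ⟨s', d₀, d₁⟩ := R
    have hb : -1 ≤ d₀ ∧ d₀ ≤ 1 ∧ -1 ≤ d₁ ∧ d₁ ≤ 1 := by
      simp only [CM.Deltas, Set.mem_insert_iff, Set.mem_singleton_iff, Prod.mk.injEq] at hD
      omega
    dsimp only at *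
    have h1 : ∀ (z : ℕ) (d : ℤ), -1 ≤ d →
        z - 1 + (d + ((decide (0 < z)).toNat : ℤ)).toNat = ((z : ℤ) + d).toNat := fun z d hd => by
      by_cases hz : 0 < z <;> simp [hz] <;> omega
    have h2 : ∀ (z : ℕ) (d : ℤ), d ≤ 1 → (d + ((decide (0 < z)).toNat : ℤ)).toNat ≤ 2 :=
      fun z d hd => by by_cases hz : 0 < z <;> simp [hz] <;> omega
    rw [h1 _ _ hb.1, h1 _ _ hb.2.2.1] at h
    exact h (h2 _ _ hb.2.1) (h2 _ _ hb.2.2.2) ih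

theorem machine_stable_iff (hΓ : CM.Valid Γ) (hG : IsTable Γ G) (sstar : Fin m) :
    (machine m sstar G).net.Stable (fun _ => 0) ↔ CM.Stable Γ (sstar, 0, 0) := by
  have hp : (machine m sstar G).Valid := machine_valid sstar.pos
  have hP : 0 < (machine m sstar G).P := hp.H_pos.trans hp.H_lt
  constructor
  · rintro ⟨M, hM⟩
    refine ⟨M, fun n => ?_⟩
    obtain ⟨x, -, hx⟩ := encodes_traj hΓ hG sstar n
    have h1 := hM (n * (machine m sstar G).P)
    rw [stateAt_eq hp, Nat.mul_mod_left, hx] at h1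
    have h2 := (le_totalQ_toState hp rfl rfl rfl rfl).trans h1
    omega
  · rintro ⟨B, hB⟩
    refine ⟨2 * B + (machine m sstar G).P + 3, fun T => ?_⟩
    rw [stateAt_eq hp]
    refine totalQ_toState_le.trans ?_
    obtain ⟨x, -, hx⟩ := encodes_traj hΓ hG sstar (T / (machine m sstar G).P)
    have h1 := run_add_le (p := machine m sstar G)
      (T / (machine m sstar G).P * (machine m sstar G).P) (T % (machine m sstar G).P)
    rw [Nat.div_add_mod', hx] at h1
    have h2 := hB (T / (machine m sstar G).P)
    have h3 := Nat.mod_lt T hP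
    dsimp only at h1
    omega

end Machine

section Encoding

open Encodable

variable {α : Type*}

theorem encode_list_eq [Encodable α] (l : List α) : encode l = encode (l.map encode) := by
  induction l with
  | nil => rfl
  | cons a l ih => simp [encode_list_cons, ih]

theorem encode_finArrow [Encodable α] {n : ℕ} (f : Fin n → α) :
    @encode _ Encodable.finArrow f = encode (List.ofFn f) := by
  refine (encode_ofEquiv (Equiv.vectorEquivFin α n).symm f).trans ?_
  rw [← List.Vector.toList_ofFn]
  rfl

theorem encode_finPi [Encodable α] {n : ℕ} (f : Fin n → α) :
    @encode _ (Encodable.finPi n fun _ => α) f =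
      encode (List.ofFn fun i => Nat.pair i (encode (f i))) := by
  refine (@encode_ofEquiv _ _ (_) (Equiv.piEquivSubtypeSigma (Fin n) fun _ => α) f).trans ?_
  refine (@Encodable.Subtype.encode_eq _ _ (_) _ _).trans ?_
  refine (encode_finArrow _).trans ?_
  rw [encode_list_eq, List.map_ofFn]
  rfl

/-- The code of a function on `Fin n` whose values have the codes `g 0, …, g (n - 1)`. -/
def funCode (n : ℕ) (g : ℕ → ℕ) : ℕ := encode ((List.range n).map fun c => Nat.pair c (g c))

theorem encode_finPi_eq_funCode [Encodable α] {n : ℕ} {f : Fin n → α} {g : ℕ → ℕ}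
    (h : ∀ i, encode (f i) = g i) : @encode _ (Encodable.finPi n fun _ => α) f = funCode n g := by
  simp only [encode_finPi, h, funCode, List.ofFn_eq_map, ← List.map_coe_finRange_eq_range,
    List.map_map]
  rfl

theorem encode_natRat (k : ℕ) : encode (k : ℚ) = Nat.pair (2 * k) 1 := by
  change Nat.pair (encode ((k : ℚ).num)) (encode (k : ℚ).den) = _
  simp only [Rat.num_natCast, Rat.den_natCast]
  rfl

theorem primrec_funCode [Primcodable α] {N : α → ℕ} {g : α → ℕ → ℕ} (hN : Primrec N)
    (hg : Primrec₂ g) : Primrec fun a => funCode (N a) (g a) :=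
  Primrec.encode.comp (Primrec.list_map (Primrec.list_range.comp hN)
    (Primrec₂.natPair.comp Primrec.snd hg))

end Encoding

section Code

open Encodable

/-- The code of the network of a slot program, started empty. -/
def netCode (p : SlotProgram) : ℕ :=
  let N := 2 * p.P + 4
  Nat.pair 3 (Nat.pair N
    (Nat.pair (funCode N fun c => p.srvN c % 3)
    (Nat.pair (funCode N fun c => if c < 4 then 0 else 1)
    (Nat.pair (funCode N fun c => if c < 2 then 0 else
      if c < 4 + p.P then Nat.pair (2 * p.P) 1 + 1 else 0)
    (Nat.pair (funCode N fun c => Nat.pair (2 * p.delayN c) 1)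
    (Nat.pair (funCode N fun c => Nat.pair (2 * p.servN c) 1)
    (Nat.pair (funCode N fun c => if p.nextN c = 0 then 0 else (p.nextN c - 1) % N + 1)
    (Nat.pair (funCode N prioN) (funCode N fun _ => 0)))))))))

theorem code_net (p : SlotProgram) : p.net.code (fun _ => 0) = p.netCode := by
  unfold MQNet.code
  refine (encode_sigma_val _ _).trans (congrArg _ ?_)
  refine (encode_sigma_val _ _).trans (congrArg _ ?_)
  simp only [encode_prod_val]
  refine congrArg₂ _ (encode_finPi_eq_funCode fun i => rfl) ?_
  refine congrArg₂ _ (encode_finPi_eq_funCode fun i => ?_) ?_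
  · split_ifs <;> rfl
  refine congrArg₂ _ (encode_finPi_eq_funCode fun i => ?_) ?_
  · split_ifs
    · rfl
    · rw [encode_some, encode_natRat]
    · rfl
  refine congrArg₂ _ (encode_finPi_eq_funCode fun i => encode_natRat _) ?_
  refine congrArg₂ _ (encode_finPi_eq_funCode fun i => encode_natRat _) ?_
  refine congrArg₂ _ (encode_finPi_eq_funCode fun i => ?_) ?_
  · split_ifs
    · rfl
    · rfl
  exact congrArg₂ _ (encode_finPi_eq_funCode fun i => rfl) (encode_finPi_eq_funCode fun i => rfl)

variable {α : Type*} [Primcodable α]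

/-- A family of slot programs all of whose data are primitive recursive. -/
structure PrimrecFamily (p : α → SlotProgram) : Prop where
  P : Primrec fun a => (p a).P
  H : Primrec fun a => (p a).H
  gate : Primrec₂ fun a => (p a).gate
  dur : Primrec₂ fun a => (p a).dur
  add : Primrec₂ fun a => (p a).add

theorem primrec_lt {f g : α → ℕ} (hf : Primrec f) (hg : Primrec g) :
    PrimrecPred fun a => f a < g a := Primrec.nat_lt.comp hf hg

theorem primrec_eq {f g : α → ℕ} (hf : Primrec f) (hg : Primrec g) :
    PrimrecPred fun a => f a = g a := Primrec.eq.comp hf hg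

theorem PrimrecFamily.netCode {p : α → SlotProgram} (h : PrimrecFamily p) :
    Primrec fun a => (p a).netCode := by
  have k (n : ℕ) : Primrec fun _ : α × ℕ => n := Primrec.const n
  have hc : Primrec fun z : α × ℕ => z.2 := Primrec.snd
  have hP : Primrec fun z : α × ℕ => (p z.1).P := h.P.comp Primrec.fst
  have hH : Primrec fun z : α × ℕ => (p z.1).H := h.H.comp Primrec.fst
  have h4P : Primrec fun z : α × ℕ => 4 + (p z.1).P := Primrec.nat_add.comp (k 4) hP
  have hN : Primrec fun a => 2 * (p a).P + 4 :=
    Primrec.nat_add.comp (Primrec.nat_mul.comp (Primrec.const 2) h.P) (Primrec.const 4)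
  have hN' : Primrec fun z : α × ℕ => 2 * (p z.1).P + 4 := hN.comp Primrec.fst
  have h4 : PrimrecPred fun z : α × ℕ => z.2 < 4 := primrec_lt hc (k 4)
  have h2 : PrimrecPred fun z : α × ℕ => z.2 < 2 := primrec_lt hc (k 2)
  have hp : PrimrecPred fun z : α × ℕ => z.2 < 4 + (p z.1).P := primrec_lt hc h4P
  have hsub : Primrec fun z : α × ℕ => z.2 - 4 := Primrec.nat_sub.comp hc (k 4)
  have hsub' : Primrec fun z : α × ℕ => z.2 - (4 + (p z.1).P) := Primrec.nat_sub.comp hc h4P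
  have rat {f : α × ℕ → ℕ} (hf : Primrec f) : Primrec fun z => Nat.pair (2 * f z) 1 :=
    Primrec₂.natPair.comp (Primrec.nat_mul.comp (k 2) hf) (k 1)
  have hsrv : Primrec fun z : α × ℕ => (p z.1).srvN z.2 :=
    Primrec.ite h4 (Primrec.nat_mod.comp hc (k 2))
      (Primrec.ite hp (h.gate.comp Primrec.fst hsub) (k 2))
  have hdelay : Primrec fun z : α × ℕ => (p z.1).delayN z.2 := Primrec.ite h4 hH hsub
  have hserv : Primrec fun z : α × ℕ => (p z.1).servN z.2 :=
    Primrec.ite h2 hH (Primrec.ite h4 (Primrec.nat_sub.comp hP hH)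
      (Primrec.ite hp (k 0) (h.dur.comp Primrec.fst hsub')))
  have hnext : Primrec fun z : α × ℕ => (p z.1).nextN z.2 :=
    Primrec.ite h4 (k 0) (Primrec.ite hp
      (Primrec.nat_add.comp (Primrec.nat_add.comp hc hP) (k 1)) (h.add.comp Primrec.fst hsub'))
  have hprio : Primrec fun z : α × ℕ => prioN z.2 :=
    Primrec.ite h2 (Primrec.nat_add.comp hc (k 2))
      (Primrec.ite h4 (Primrec.nat_sub.comp hc (k 2)) hc)
  refine Primrec₂.natPair.comp (Primrec.const 3) (Primrec₂.natPair.comp hN ?_)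
  refine Primrec₂.natPair.comp (primrec_funCode hN (Primrec.nat_mod.comp hsrv (k 3))) ?_
  refine Primrec₂.natPair.comp (primrec_funCode hN (Primrec.ite h4 (k 0) (k 1))) ?_
  refine Primrec₂.natPair.comp (primrec_funCode hN (Primrec.ite h2 (k 0)
    (Primrec.ite hp (Primrec.nat_add.comp (rat hP) (k 1)) (k 0)))) ?_
  refine Primrec₂.natPair.comp (primrec_funCode hN (rat hdelay)) ?_
  refine Primrec₂.natPair.comp (primrec_funCode hN (rat hserv)) ?_
  refine Primrec₂.natPair.comp (primrec_funCode hN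
    (Primrec.ite (primrec_eq hnext (k 0)) (k 0)
      (Primrec.nat_add.comp (Primrec.nat_mod.comp (Primrec.nat_sub.comp hnext (k 1)) hN')
        (k 1)))) ?_
  exact Primrec₂.natPair.comp (primrec_funCode hN hprio) (primrec_funCode hN (k 0))

theorem PrimrecFamily.machine {m s₀ : α → ℕ} {G : α → ℕ → ℕ × ℕ × ℕ} (hm : Primrec m)
    (hs : Primrec s₀) (hG : Primrec₂ G) : PrimrecFamily fun a => machine (m a) (s₀ a) (G a) := by
  have k (n : ℕ) : Primrec fun _ : α × ℕ => n := Primrec.const n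
  have hx : Primrec fun z : α × ℕ => z.2 := Primrec.snd
  have mulm (n : ℕ) : Primrec fun z : α × ℕ => n * m z.1 :=
    Primrec.nat_mul.comp (k n) (hm.comp Primrec.fst)
  have page (n : ℕ) : PrimrecPred fun z : α × ℕ => z.2 / (4 * m z.1) = n :=
    primrec_eq (Primrec.nat_div.comp hx (mulm 4)) (k n)
  have modk (n : ℕ) : PrimrecPred fun z : α × ℕ => z.2 % n = 0 :=
    primrec_eq (Primrec.nat_mod.comp hx (k n)) (k 0)
  have hval : Primrec fun z : α × ℕ => G z.1 (z.2 % (4 * m z.1)) :=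
    hG.comp Primrec.fst (Primrec.nat_mod.comp hx (mulm 4))
  have jump {n : ℕ} {f : α × ℕ → ℕ} (hf : Primrec f) :
      Primrec fun z : α × ℕ => n * m z.1 + 4 * f z - z.2 :=
    Primrec.nat_sub.comp (Primrec.nat_add.comp (mulm n) (Primrec.nat_mul.comp (k 4) hf)) hx
  have le (n : ℕ) {f : α × ℕ → ℕ} (hf : Primrec f) : PrimrecPred fun z => n ≤ f z :=
    Primrec.nat_le.comp (k n) hf
  have hfst := Primrec.fst.comp (Primrec.snd.comp hval)
  have hsnd := Primrec.snd.comp (Primrec.snd.comp hval)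
  refine ⟨Primrec.nat_mul.comp (Primrec.const 28) hm, Primrec.nat_mul.comp (Primrec.const 12) hm,
    ?_, ?_, ?_⟩
  · exact Primrec.ite ((page 1).and (modk 4)) (k 0)
      (Primrec.ite ((page 2).and (modk 2)) (k 1) (k 2))
  · exact Primrec.ite (page 0) (jump (hs.comp Primrec.fst))
      (Primrec.ite (page 6) (jump (Primrec.fst.comp hval))
        (Primrec.ite ((page 1).and (modk 4).not) (Primrec.nat_add.comp (mulm 4) (k 1)) (mulm 4)))
  · exact Primrec.ite (((page 2).and (le 1 hfst)).or ((page 3).and (le 2 hfst))) (k 1)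
      (Primrec.ite (((page 4).and (le 1 hsnd)).or ((page 5).and (le 2 hsnd))) (k 2) (k 0))

end Code

section Table

open Encodable

variable {m : ℕ}

theorem encode_ofFn {α β : Type*} [Encodable α] [Encodable β] {n : ℕ} {f : Fin n → α}
    {g : Fin n → β} (h : ∀ i, encode (f i) = encode (g i)) :
    encode (List.ofFn f) = encode (List.ofFn g) := by
  rw [encode_list_eq, encode_list_eq (List.ofFn g), List.map_ofFn, List.map_ofFn]
  exact congrArg _ (congrArg _ (funext h))

/-- The graph of a function on `Fin n`, as a list. -/
def graph {α : Type*} {n : ℕ} (f : Fin n → α) : List (ℕ × α) := List.ofFn fun i => ((i : ℕ), f i)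

theorem getD_graph {α : Type*} {n : ℕ} (f : Fin n → α) (i : Fin n) (d : ℕ × α) :
    (graph f).getD i d = ((i : ℕ), f i) := by
  simp [graph, List.getD_eq_getElem?_getD]

theorem encode_graph {α β : Type*} [Encodable α] [Encodable β] {n : ℕ} {f : Fin n → α}
    {g : Fin n → β} (h : ∀ i, encode (f i) = encode (g i)) :
    encode (List.ofFn fun i => Nat.pair i (encode (f i))) = encode (graph g) :=
  encode_ofFn fun i => congrArg (Nat.pair i) (h i)

/-- The numbering of `Bool` used to encode functions on `Bool`. -/
def boolEquiv : Bool ≃ Fin 2 := fintypeEquivFin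

theorem encode_boolArrow {α β : Type*} [Encodable α] [Encodable β] {f : Bool → α}
    {g : Bool → β} (h : ∀ i, encode (f i) = encode (g i)) :
    encode f = encode (graph fun i => g (boolEquiv.symm i)) :=
  (encode_finPi (n := 2) fun i => f (boolEquiv.symm i)).trans (encode_graph fun _ => h _)

/-- Transition tables of two-counter machines: nested lists of the states and the codes of the
increments. -/
abbrev RawTable : Type := List (ℕ × List (ℕ × List (ℕ × ℕ × ℕ × ℕ)))

/-- The transition table of a two-counter machine. -/
def rawTable (Γ : Fin m → Bool → Bool → Fin m × ℤ × ℤ) : RawTable :=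
  graph fun s => graph fun i => graph fun j =>
    let r := Γ s (boolEquiv.symm i) (boolEquiv.symm j)
    ((r.1 : ℕ), encode r.2.1, encode r.2.2)

theorem encode_machine (Γ : Fin m → Bool → Bool → Fin m × ℤ × ℤ) (sstar : Fin m) :
    encode (⟨m, Γ, sstar⟩ : CMStateCode) = encode (m, rawTable Γ, (sstar : ℕ)) := by
  refine (encode_sigma_val _ _).trans (congrArg (Nat.pair m) ?_)
  refine congrArg (fun c => Nat.pair c sstar) ((encode_finPi Γ).trans (encode_graph fun s => ?_))
  exact encode_boolArrow (g := fun b => graph fun j =>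
    (((Γ s b (boolEquiv.symm j)).1 : ℕ), encode (Γ s b (boolEquiv.symm j)).2.1,
      encode (Γ s b (boolEquiv.symm j)).2.2)) fun b => encode_boolArrow
        (g := fun b' => (((Γ s b b').1 : ℕ), encode (Γ s b b').2.1, encode (Γ s b b').2.2))
        fun _ => rfl

/-- The position of a truth value in the encoding of functions on `Bool`. -/
def boolPos (v : ℕ) : ℕ := if v = 1 then boolEquiv true else boolEquiv false

theorem boolPos_toNat (b : Bool) : boolPos b.toNat = boolEquiv b := by cases b <;> rfl

/-- The sum of a number and the increment with a given code. -/
def shift (e v : ℕ) : ℕ := if e = 0 then v else if e = 1 then v - 1 else v + 1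

theorem shift_encode {z : ℤ} (h : z = -1 ∨ z = 0 ∨ z = 1) (b : Bool) :
    shift (encode z) b.toNat = (z + (b.toNat : ℤ)).toNat := by
  rcases h with rfl | rfl | rfl <;> cases b <;> rfl

/-- The successor state and the augmented increments found in a table at a given index. -/
def lookup (l : RawTable) (y : ℕ) : ℕ × ℕ × ℕ :=
  let r := (((l.getD (y / 4) default).2.getD (boolPos (y / 2 % 2)) default).2.getD
    (boolPos (y % 2)) default).2
  (r.1, shift r.2.1 (y / 2 % 2), shift r.2.2 (y % 2))

theorem isTable_lookup {Γ : Fin m → Bool → Bool → Fin m × ℤ × ℤ} (hΓ : CM.Valid Γ) :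
    IsTable Γ (lookup (rawTable Γ)) := by
  intro s b₀ b₁
  have h₀ := Bool.toNat_lt b₀
  have h₁ := Bool.toNat_lt b₁
  have e₁ : index s b₀ b₁ / 4 = s := by unfold index; omega
  have e₂ : index s b₀ b₁ / 2 % 2 = b₀.toNat := by unfold index; omega
  have e₃ : index s b₀ b₁ % 2 = b₁.toNat := by unfold index; omega
  have hd : ((Γ s b₀ b₁).2.1 = -1 ∨ (Γ s b₀ b₁).2.1 = 0 ∨ (Γ s b₀ b₁).2.1 = 1) ∧
      ((Γ s b₀ b₁).2.2 = -1 ∨ (Γ s b₀ b₁).2.2 = 0 ∨ (Γ s b₀ b₁).2.2 = 1) := by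
    have h := hΓ.1 s b₀ b₁
    generalize (Γ s b₀ b₁).2 = d at *
    simp only [CM.Deltas, Set.mem_insert_iff, Set.mem_singleton_iff] at h
    rcases h with rfl | rfl | rfl | rfl | rfl <;> simp
  simp only [lookup, e₁, e₂, e₃, boolPos_toNat, rawTable, getD_graph, Equiv.symm_apply_apply,
    shift_encode hd.1, shift_encode hd.2]

theorem primrec_boolPos : Primrec boolPos :=
  Primrec.ite (primrec_eq Primrec.id (Primrec.const 1)) (Primrec.const _) (Primrec.const _)

theorem primrec_shift : Primrec₂ shift :=
  Primrec.ite (primrec_eq Primrec.fst (Primrec.const 0)) Primrec.snd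
    (Primrec.ite (primrec_eq Primrec.fst (Primrec.const 1))
      (Primrec.nat_sub.comp Primrec.snd (Primrec.const 1))
      (Primrec.nat_add.comp Primrec.snd (Primrec.const 1)))

theorem primrec_lookup : Primrec₂ lookup := by
  have k (n : ℕ) : Primrec fun _ : RawTable × ℕ => n := Primrec.const n
  have hy : Primrec fun z : RawTable × ℕ => z.2 := Primrec.snd
  have h₀ : Primrec fun z : RawTable × ℕ => z.2 / 2 % 2 :=
    Primrec.nat_mod.comp (Primrec.nat_div.comp hy (k 2)) (k 2)
  have h₁ : Primrec fun z : RawTable × ℕ => z.2 % 2 := Primrec.nat_mod.comp hy (k 2)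
  have hl := Primrec.snd.comp ((Primrec.list_getD default).comp Primrec.fst
    (Primrec.nat_div.comp hy (k 4)))
  have hk := Primrec.snd.comp ((Primrec.list_getD default).comp hl (primrec_boolPos.comp h₀))
  have hr := Primrec.snd.comp ((Primrec.list_getD default).comp hk (primrec_boolPos.comp h₁))
  have hz := Primrec.snd.comp hr
  exact Primrec.pair (Primrec.fst.comp hr) (Primrec.pair
    (primrec_shift.comp (Primrec.fst.comp hz) h₀) (primrec_shift.comp (Primrec.snd.comp hz) h₁))

/-- The slot program of an encoded two-counter machine. -/
def ofRaw (d : ℕ × RawTable × ℕ) : SlotProgram := machine d.1 d.2.2 (lookup d.2.1)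

theorem primrec_netCode_ofRaw : Primrec fun d => (ofRaw d).netCode := by
  have h : Primrec₂ fun (d : ℕ × RawTable × ℕ) (y : ℕ) => lookup d.2.1 y :=
    primrec_lookup.comp (Primrec.fst.comp (Primrec.snd.comp Primrec.fst)) Primrec.snd
  exact (PrimrecFamily.machine Primrec.fst (Primrec.snd.comp Primrec.snd) h).netCode

/-- The reduction, on codes. -/
def reduction (n : ℕ) : ℕ := (ofRaw ((decode n).getD default)).netCode

theorem computable_reduction : Computable reduction :=
  (primrec_netCode_ofRaw.comp
    (Primrec.option_getD.comp Primrec.decode (Primrec.const default))).to_comp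

theorem reduction_encode (d : ℕ × RawTable × ℕ) : reduction (encode d) = (ofRaw d).netCode := by
  rw [reduction, encodek]
  rfl

end Table

theorem cap_net (i : Fin p.net.N) : p.net.cap i = none ∨ p.net.cap i = some 0 := by
  dsimp only [net]
  split_ifs <;> simp

theorem Valid.exists_serv_eq_zero (hp : p.Valid) : ∃ i, p.net.serv i = 0 := by
  have hP : 0 < p.P := hp.H_pos.trans hp.H_lt
  refine ⟨p.cls 4, ?_⟩
  simp only [Nat.cast_eq_zero, servN, val_cls (show 4 < 2 * p.P + 4 by omega)]
  split_ifs <;> omega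

end SlotProgram

/-- The reduction from simplified counter machines to queueing networks: computably from
a code of an SCM `(Γ, s*)` one can construct a deterministic multiclass queueing network
with rational interarrival times, delays and service times (some of them zero) and
buffer capacities equal to `0` or `∞`, a nonpreemptive static buffer priority policy,
and an initial queue-length vector, such that the resulting triple `(Q, θ, Q(0))` is
stable if and only if the SCM started at `(s*, 0, 0)` is stable. -/
theorem scm_to_queueing_network_reduction :
    ∃ f : ℕ → ℕ, Computable f ∧
      ∀ (m : ℕ) (Γ : Fin m → Bool → Bool → Fin m × ℤ × ℤ) (sstar : Fin m),
        CM.Valid Γ → CM.IsSCM Γ →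
          ∃ (net : MQNet) (Q0 : Fin net.N → ℕ),
            f (Encodable.encode (⟨m, Γ, sstar⟩ : CMStateCode)) = net.code Q0 ∧
            net.WellFormed ∧
            (∀ i, net.cap i = none ∨ net.cap i = some 0) ∧
            (∃ i, net.serv i = 0) ∧
            (net.Stable Q0 ↔ CM.Stable Γ (sstar, 0, 0)) := by
  refine ⟨SlotProgram.reduction, SlotProgram.computable_reduction, fun m Γ sstar hΓ _ => ?_⟩
  have hp := SlotProgram.machine_valid (s₀ := sstar)
    (G := SlotProgram.lookup (SlotProgram.rawTable Γ)) sstar.pos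
  refine ⟨_, fun _ => 0, ?_, hp.wellFormed, SlotProgram.cap_net, hp.exists_serv_eq_zero,
    SlotProgram.machine_stable_iff hΓ (SlotProgram.isTable_lookup hΓ) sstar⟩
  rw [SlotProgram.encode_machine, SlotProgram.reduction_encode, SlotProgram.code_net]
  rfl
end

section
/- Let R be an N × N real matrix all of whose entries lie in {0, 1} and each of whose row sums is at most 1. If every complex eigenvalue of R has modulus strictly less than 1 (i.e., R has spectral radius < 1), then R is nilpotent: R^N = 0. -/
open Polynomial in
/-- A matrix over an algebraically closed field whose only eigenvalue is `0` is nilpotent, with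
exponent the size of the matrix. -/
theorem Matrix.pow_card_eq_zero_of_spectrum_subset {K n : Type*} [Field K] [IsAlgClosed K]
    [Fintype n] [DecidableEq n] (A : Matrix n n K) (hA : spectrum K A ⊆ {0}) :
    A ^ Fintype.card n = 0 := by
  have hs := IsAlgClosed.splits A.charpoly
  have hroots : A.charpoly.roots = Multiset.replicate (Fintype.card n) 0 := by
    refine Multiset.eq_replicate.mpr ⟨?_, fun z hz => ?_⟩
    · rw [← hs.natDegree_eq_card_roots, A.charpoly_natDegree_eq_dim]
    · exact hA (A.mem_spectrum_of_isRoot_charpoly (isRoot_of_mem_roots hz))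
  have hX : A.charpoly = X ^ Fintype.card n := by
    rw [hs.eq_prod_roots_of_monic A.charpoly_monic, hroots]
    simp
  simpa [hX] using A.aeval_self_charpoly

open Polynomial in
/-- If two distinct powers of an element of an algebra over a field agree, every nonzero spectral
value is a root of unity. -/
theorem spectrum.pow_eq_pow_of_mem {K A : Type*} [Field K] [Ring A] [Algebra K A] {a : A} {m n : ℕ}
    (h : a ^ m = a ^ n) {z : K} (hz : z ∈ spectrum K a) : z ^ m = z ^ n := by
  have : Nontrivial A := by
    by_contra hA
    rw [not_nontrivial_iff_subsingleton] at hA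
    simp [spectrum.of_subsingleton] at hz
  have hmem := spectrum.subset_polynomial_aeval a (X ^ m - X ^ n : K[X]) ⟨z, hz, rfl⟩
  simpa [h, sub_eq_zero] using hmem

/-- The natural number matrices with row sums at most `1` are closed under powers. -/
theorem Matrix.sum_pow_apply_le_one {n : Type*} [Fintype n] [DecidableEq n] {A : Matrix n n ℕ}
    (hA : ∀ i, ∑ j, A i j ≤ 1) (k : ℕ) (i : n) : ∑ j, (A ^ k) i j ≤ 1 := by
  induction k generalizing i with
  | zero => simp [Matrix.one_apply]
  | succ k ih =>
    calc ∑ j, (A ^ (k + 1)) i j = ∑ l, (A ^ k) i l * ∑ j, A l j := by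
          simp only [pow_succ, Matrix.mul_apply, Finset.mul_sum]
          exact Finset.sum_comm
      _ ≤ ∑ l, (A ^ k) i l := Finset.sum_le_sum fun l _ => mul_le_of_le_one_right (Nat.zero_le _) (hA l)
      _ ≤ 1 := ih i

/-- Two distinct powers of a natural number matrix with row sums at most `1` agree. -/
theorem Matrix.exists_pow_eq_pow_of_sum_le_one {n : Type*} [Fintype n] [DecidableEq n]
    {A : Matrix n n ℕ} (hA : ∀ i, ∑ j, A i j ≤ 1) : ∃ a b : ℕ, a < b ∧ A ^ a = A ^ b := by
  have hfin : {M : Matrix n n ℕ | ∀ i j, M i j ≤ 1}.Finite :=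
    (Set.finite_Iic (fun _ _ => 1 : n → n → ℕ)).subset fun _ hM => hM
  refine Set.Finite.exists_lt_map_eq_of_forall_mem (f := fun k => A ^ k) (fun k => ?_) hfin
  refine Set.mem_ofPred.mpr fun i j => ?_
  exact (Finset.single_le_sum (fun _ _ => Nat.zero_le _) (Finset.mem_univ j)).trans
    (sum_pow_apply_le_one hA k i)

/-- A 0–1 substochastic `N × N` matrix (entries in `{0, 1}`, row sums at most 1) whose
spectral radius is less than 1 (every complex eigenvalue has modulus `< 1`) is
nilpotent: `R ^ N = 0`. -/
theorem zero_one_substochastic_spectral_radius_lt_one_nilpotent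
    (N : ℕ) (hN : 0 < N) (R : Matrix (Fin N) (Fin N) ℝ)
    (h01 : ∀ i l, R i l = 0 ∨ R i l = 1)
    (hrow : ∀ i, ∑ l, R i l ≤ 1)
    (hspec : ∀ z ∈ spectrum ℂ (R.map (fun x => (x : ℂ))), ‖z‖ < 1) :
    R ^ N = 0 := by
  obtain ⟨A, rfl⟩ : ∃ A : Matrix (Fin N) (Fin N) ℕ, R = A.map (Nat.castRingHom ℝ) := by
    choose A hA using fun i l => show ∃ a : ℕ, R i l = a from
      (h01 i l).elim (fun h => ⟨0, by simpa using h⟩) fun h => ⟨1, by simpa using h⟩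
    exact ⟨Matrix.of A, by ext i l; simpa using hA i l⟩
  have hsum : ∀ i, ∑ l, A i l ≤ 1 := fun i => by
    have := hrow i
    simp only [Matrix.map_apply, Nat.coe_castRingHom] at this
    exact_mod_cast this
  have hmap : (A.map (Nat.castRingHom ℝ)).map (fun x => (x : ℂ)) = A.map (Nat.castRingHom ℂ) := by
    ext i l
    simp
  rw [hmap] at hspec
  obtain ⟨a, b, hab, hpow⟩ := Matrix.exists_pow_eq_pow_of_sum_le_one hsum
  have hpowC : A.map (Nat.castRingHom ℂ) ^ a = A.map (Nat.castRingHom ℂ) ^ b := by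
    rw [← Matrix.map_pow, ← Matrix.map_pow, hpow]
  have hzero : A.map (Nat.castRingHom ℂ) ^ N = 0 := by
    have h := Matrix.pow_card_eq_zero_of_spectrum_subset (A.map (Nat.castRingHom ℂ)) fun z hz => by
      by_contra hz0
      have hnorm : ‖z‖ ^ a = ‖z‖ ^ b := by
        rw [← norm_pow, ← norm_pow, spectrum.pow_eq_pow_of_mem hpowC hz]
      exact (pow_lt_pow_right_of_lt_one₀ (norm_pos_iff.mpr hz0) (hspec z hz) hab).ne' hnorm
    rwa [Fintype.card_fin] at h
  have hA : A ^ N = 0 := by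
    ext i l
    rw [← Matrix.map_pow] at hzero
    simpa using congrFun₂ hzero i l
  rw [← Matrix.map_pow, hA]
  simp
end
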